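/- arXiv:1110.5007 — 2 statements merged into one kernel-verified Lean document; each statement's English description precedes it below -/
import Mathlib

section
/- Let 3 ≤ k ≤ n−1 and let H' be the k-uniform hypergraph on {1,...,n} whose hyperedges are all k-element subsets of {1,...,n} containing the vertex 1. Then dim HC_r(Δ(H')^C) = C(n−1, r+1) for n−2 ≥ r ≥ n−k+1, dim HC_{n−k}(Δ(H')^C) = C(n−1, n−k+1), and HC_r(Δ(H')^C) = 0 for all r ≤ n−k−1. -/
open Function

/-- The map `Fin (m+1) → Fin m` which merges the blocks `j` and `j+1` of an
ordered set partition with `m+1` blocks (blocks are indexed from `0`). -/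
def mergeMap {m : ℕ} (j : Fin m) : Fin (m + 1) → Fin m := fun x =>
  if h : (x : ℕ) ≤ (j : ℕ) then ⟨(x : ℕ), lt_of_le_of_lt h j.isLt⟩
  else ⟨(x : ℕ) - 1, by have h1 := x.isLt; have h2 := j.isLt; omega⟩

/-- The linear map between spaces of `R`-valued functions on finite bases
given by a "matrix" `M` (rows indexed by `α`, columns by `β`). -/
def matLin {R : Type} [CommRing R] {α β : Type} [Fintype α] (M : α → β → R) :
    (α → R) →ₗ[R] (β → R) where
  toFun c := fun b => ∑ a, c a * M a b
  map_add' x y := by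
    funext b
    simp [add_mul, Finset.sum_add_distrib]
  map_smul' r x := by
    funext b
    simp [Finset.mul_sum, mul_assoc]

/-- Homology of a (piece of a) chain complex: the kernel of the outgoing map `d1`
modulo the image of the incoming map `d2`. -/
abbrev homologyOf {R A B C : Type} [CommRing R] [AddCommGroup A] [AddCommGroup B] [AddCommGroup C]
    [Module R A] [Module R B] [Module R C] (d2 : A →ₗ[R] B) (d1 : B →ₗ[R] C) :=
  LinearMap.ker d1 ⧸ (LinearMap.range d2).comap (LinearMap.ker d1).subtype

/-- The canonical representatives of faces of the cyclic coloring complex: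
ordered set partitions of `{0, …, n-1}` (vertex `i` stands for the vertex `i+1` of the paper)
into `m` nonempty blocks, encoded as surjections `f : Fin n → Fin m` (block `B_{i+1}` is the
fiber `f⁻¹ i`), such that the block containing the vertex `0` is the first one, and
satisfying the extra condition `P m f` (used to encode hyperedge conditions). -/
def CycBas (n : ℕ) (P : (m : ℕ) → (Fin n → Fin m) → Prop) (m : ℕ) :=
  {f : Fin n → Fin m // Surjective f ∧ (∀ x : Fin n, (x : ℕ) = 0 → (f x : ℕ) = 0) ∧ P m f}

instance (n : ℕ) (P : (m : ℕ) → (Fin n → Fin m) → Prop) (m : ℕ) : Finite (CycBas n P m) := by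
  unfold CycBas; infer_instance

noncomputable instance (n : ℕ) (P : (m : ℕ) → (Fin n → Fin m) → Prop) (m : ℕ) :
    Fintype (CycBas n P m) := Fintype.ofFinite _

instance (n : ℕ) (P : (m : ℕ) → (Fin n → Fin m) → Prop) (m : ℕ) :
    DecidableEq (CycBas n P m) := by unfold CycBas; infer_instance

/-- The matrix of the boundary map of the cyclic coloring complex, from chains with `m+1`
blocks to chains with `m` blocks.  The first summand comes from merging consecutive blocks
`B_i, B_{i+1}` (`1 ≤ i ≤ r+1`, with sign `(-1)^{i+1}`), the second from merging `B_1` with the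
last block `B_{r+2}` (with sign `(-1)^{r+3}`, and `r + 2 = m + 1`).  Terms whose merged
partition does not satisfy the condition `P` do not appear (they match no element `g`). -/
def cycMat (n : ℕ) (P : (m : ℕ) → (Fin n → Fin m) → Prop) (m : ℕ)
    (f : CycBas n P (m + 1)) (g : CycBas n P m) : ℚ :=
  (∑ j : Fin m, (-1 : ℚ) ^ (j : ℕ) * (if mergeMap j ∘ f.1 = g.1 then 1 else 0))
    + (-1 : ℚ) ^ m * (if (∀ y : Fin n, ((f.1 y : ℕ) = m → (g.1 y : ℕ) = 0) ∧
        ((f.1 y : ℕ) ≠ m → (g.1 y : ℕ) = (f.1 y : ℕ))) then 1 else 0)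

/-- The boundary map of the cyclic coloring complex. -/
noncomputable def cycBnd (n : ℕ) (P : (m : ℕ) → (Fin n → Fin m) → Prop) (m : ℕ) :
    (CycBas n P (m + 1) → ℚ) →ₗ[ℚ] (CycBas n P m → ℚ) := matLin (cycMat n P m)

/-- Hyperedge condition for the complex `Δ(H)` where `H` is the complete `k`-uniform
hypergraph on `n` vertices: at least one block (= fiber of `f`) contains a hyperedge,
i.e. some `k`-element subset of the vertices lies inside one block. -/
def completeIn (n k : ℕ) : (m : ℕ) → (Fin n → Fin m) → Prop := fun m f =>
  ∃ e : Finset (Fin n), e.card = k ∧ ∃ i : Fin m, ∀ x ∈ e, f x = i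

/-- Hyperedge condition for the complex `Δ(H)` where `H` is the `k`-uniform star
hypergraph at the vertex `1` (encoded as the element of `Fin n` with value `0`):
some block contains a `k`-element set containing the vertex `1`. -/
def starIn (n k : ℕ) : (m : ℕ) → (Fin n → Fin m) → Prop := fun m f =>
  ∃ e : Finset (Fin n), e.card = k ∧ (∀ x : Fin n, (x : ℕ) = 0 → x ∈ e) ∧
    ∃ i : Fin m, ∀ x ∈ e, f x = i

/-- Condition for the quotient complex `Δ(H)^C` where `H` is the complete `k`-uniform
hypergraph: no block contains a hyperedge. -/
def completeFree (n k : ℕ) : (m : ℕ) → (Fin n → Fin m) → Prop := fun m f =>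
  ∀ e : Finset (Fin n), e.card = k → ∀ i : Fin m, ∃ x ∈ e, f x ≠ i

/-- Condition for the quotient complex `Δ(H')^C` where `H'` is the `k`-uniform star
hypergraph at the vertex `1`: no block contains a hyperedge of `H'`. -/
def starFree (n k : ℕ) : (m : ℕ) → (Fin n → Fin m) → Prop := fun m f =>
  ∀ e : Finset (Fin n), e.card = k → (∀ x : Fin n, (x : ℕ) = 0 → x ∈ e) →
    ∀ i : Fin m, ∃ x ∈ e, f x ≠ i


/-- A square system whose matrix is triangular with respect to a potential `Φ`. -/
structure TriangularMatching {C' C : Type} (M : C' → C → ℚ) (U : Set C) (s : U → C') : Prop where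
  diag : ∀ u : U, M (s u) u ≠ 0
  lt : ∃ Φ : U → ℕ ×ₗ ℕ ×ₗ ℕ, ∀ u u' : U, u' ≠ u → M (s u) u' ≠ 0 → Φ u' < Φ u

namespace TriangularMatching

variable {C' C : Type} {M : C' → C → ℚ} {U : Set C} {s : U → C'}

lemma injective (h : TriangularMatching M U s) : Injective s := by
  obtain ⟨Φ, hΦ⟩ := h.lt
  intro u u' huu
  by_contra hne
  exact lt_asymm (hΦ u u' (Ne.symm hne) (huu ▸ h.diag u')) (hΦ u' u hne (huu ▸ h.diag u))

/-- The restriction of the boundary to the matched cells. -/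
noncomputable def restrict [Fintype C] (M : C' → C → ℚ) (U : Set C) (s : U → C') :
    (U → ℚ) →ₗ[ℚ] (U → ℚ) := by
  classical
  exact matLin (fun u u' => M (s u) u')

variable [Fintype C]

lemma restrict_injective (h : TriangularMatching M U s) : Injective (restrict M U s) := by
  classical
  obtain ⟨Φ, hΦ⟩ := h.lt
  rw [injective_iff_map_eq_zero]
  intro a ha
  by_contra hne
  obtain ⟨u₀, hu₀⟩ := Function.ne_iff.mp hne
  obtain ⟨u, hu, hmax⟩ := Finset.exists_max_image (Finset.univ.filter fun u => a u ≠ 0) Φ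
    ⟨u₀, by simpa using hu₀⟩
  simp only [Finset.mem_filter, Finset.mem_univ, true_and] at hu hmax
  have key : ∑ w, a w * M (s w) u = 0 := congrFun ha u
  rw [Finset.sum_eq_single u] at key
  · exact (mul_ne_zero hu (h.diag u)) key
  · intro w _ hw
    by_contra hz
    exact absurd (hΦ w u (Ne.symm hw) (right_ne_zero_of_mul hz))
      (not_lt.mpr (hmax w (left_ne_zero_of_mul hz)))
  · simp

variable [Fintype C']

lemma matLin_apply_of_support (h : TriangularMatching M U s) (w : C' → ℚ)
    (hw : ∀ c, c ∉ Set.range s → w c = 0) (u : U) :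
    matLin M w u = restrict M U s (fun v => w (s v)) u := by
  classical
  change ∑ a, w a * M a u = ∑ v, w (s v) * M (s v) u
  rw [← Finset.sum_image (f := fun a => w a * M a u) (s := Finset.univ) (g := s)
    (fun x _ y _ hxy => h.injective hxy)]
  symm
  apply Finset.sum_subset (Finset.subset_univ _)
  intro x _ hx
  rw [hw x (by simpa using hx), zero_mul]

lemma eq_zero_of_support (h : TriangularMatching M U s) (w : C' → ℚ)
    (hw : ∀ c, c ∉ Set.range s → w c = 0) (hU : ∀ u ∈ U, matLin M w u = 0) : w = 0 := by
  have h0 : (fun v => w (s v)) = 0 := by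
    apply h.restrict_injective
    rw [map_zero]
    funext u
    rw [← h.matLin_apply_of_support w hw u]
    exact hU u u.2
  funext c
  by_cases hc : c ∈ Set.range s
  · obtain ⟨v, rfl⟩ := hc
    exact congrFun h0 v
  · exact hw c hc

lemma exists_matLin_eq (h : TriangularMatching M U s) (v : C → ℚ) :
    ∃ t : C' → ℚ, ∀ u ∈ U, (v - matLin M t) u = 0 := by
  classical
  obtain ⟨a, ha⟩ := (LinearMap.injective_iff_surjective.mp h.restrict_injective) (fun u => v u)
  set t : C' → ℚ := fun c => if hc : c ∈ Set.range s then a hc.choose else 0 with ht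
  have hts : (fun v => t (s v)) = a := by
    funext v
    have hv : s v ∈ Set.range s := ⟨v, rfl⟩
    simp only [ht, dif_pos hv]
    rw [h.injective hv.choose_spec]
  refine ⟨t, fun u hu => ?_⟩
  have := h.matLin_apply_of_support t (fun c hc => by simp only [ht, dif_neg hc]) ⟨u, hu⟩
  rw [hts, ha] at this
  simp [this]

end TriangularMatching

/-- A family of cycles dual to the unmatched cells `K`. -/
structure DualCycles {A B : Type} [Fintype A] (M : A → B → ℚ) (U K : Set A)
    (z : K → A → ℚ) : Prop where
  cycle : ∀ e, matLin M (z e) = 0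
  vanish : ∀ e, ∀ u ∈ U, z e u = 0
  diag : ∀ e, z e e = 1
  off_diag : ∀ e e' : K, e' ≠ e → z e e' = 0

namespace DualCycles

variable {A B : Type} [Fintype A] {M : A → B → ℚ} {U K : Set A} {z : K → A → ℚ}

lemma sum_apply [Fintype K] (h : DualCycles M U K z) (a : K → ℚ) (e : K) :
    (∑ e', a e' • z e') e = a e := by
  rw [Finset.sum_apply, Finset.sum_eq_single e]
  · simp [h.diag]
  · intro e' _ he
    simp [h.off_diag e' e he.symm]
  · simp

lemma sum_vanish [Fintype K] (h : DualCycles M U K z) (a : K → ℚ) {u : A} (hu : u ∈ U) :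
    (∑ e', a e' • z e') u = 0 := by
  rw [Finset.sum_apply]
  exact Finset.sum_eq_zero fun e _ => by simp [h.vanish e u hu]

lemma sum_cycle [Fintype K] (h : DualCycles M U K z) (a : K → ℚ) :
    matLin M (∑ e', a e' • z e') = 0 := by
  simp [map_sum, h.cycle]

end DualCycles

theorem finrank_homologyOf_eq_card {A₃ A₂ A₁ A₀ : Type} [Fintype A₃] [Fintype A₂] [Fintype A₁]
    [Fintype A₀] {M₃ : A₃ → A₂ → ℚ} {M₂ : A₂ → A₁ → ℚ} {M₁ : A₁ → A₀ → ℚ}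
    {U₂ K₂ : Set A₂} {U₁ K₁ : Set A₁} {U₀ : Set A₀}
    {s₂ : U₂ → A₃} {s₁ : U₁ → A₂} {s₀ : U₀ → A₁} {z₂ : K₂ → A₂ → ℚ} {z₁ : K₁ → A₁ → ℚ}
    (h₂₃ : ∀ c, matLin M₂ (matLin M₃ c) = 0) (h₁₂ : ∀ c, matLin M₁ (matLin M₂ c) = 0)
    (t₃ : TriangularMatching M₃ U₂ s₂) (t₂ : TriangularMatching M₂ U₁ s₁)
    (t₁ : TriangularMatching M₁ U₀ s₀)
    (hz₂ : DualCycles M₂ U₂ K₂ z₂) (hz₁ : DualCycles M₁ U₁ K₁ z₁)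
    (cover₂ : ∀ a, a ∈ U₂ ∨ a ∈ K₂ ∨ a ∈ Set.range s₁)
    (cover₁ : ∀ a, a ∈ U₁ ∨ a ∈ K₁ ∨ a ∈ Set.range s₀) :
    Module.finrank ℚ (homologyOf (matLin M₂) (matLin M₁)) = Nat.card K₁ := by
  classical
  let S : Submodule ℚ (LinearMap.ker (matLin M₁)) :=
    (LinearMap.range (matLin M₂)).comap (LinearMap.ker (matLin M₁)).subtype
  let zk : K₁ → LinearMap.ker (matLin M₁) := fun e => ⟨z₁ e, hz₁.cycle e⟩
  let L : (K₁ → ℚ) →ₗ[ℚ] LinearMap.ker (matLin M₁) := Fintype.linearCombination ℚ zk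
  have hL : ∀ a, ((L a : LinearMap.ker (matLin M₁)) : A₁ → ℚ) = ∑ e, a e • z₁ e := by
    intro a
    simp [L, zk, Fintype.linearCombination_apply]
  have hbij : Bijective (S.mkQ ∘ₗ L) := by
    constructor
    · rw [injective_iff_map_eq_zero]
      intro a ha
      have ha' : L a ∈ S := by simpa using ha
      obtain ⟨w, hw⟩ : ∃ w, matLin M₂ w = ∑ e, a e • z₁ e := by
        obtain ⟨w, hw⟩ := ha'
        exact ⟨w, by rw [hw, ← hL]; rfl⟩
      obtain ⟨t, ht⟩ := t₃.exists_matLin_eq w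
      set w₁ := w - matLin M₃ t with hw₁
      set w₂ := w₁ - ∑ e : K₂, w₁ e • z₂ e with hw₂
      have hd : matLin M₂ w₂ = ∑ e, a e • z₁ e := by
        rw [hw₂, map_sub, hz₂.sum_cycle (fun e => w₁ e), hw₁, map_sub, h₂₃, hw]
        simp
      have h0 : w₂ = 0 := by
        apply t₂.eq_zero_of_support
        · intro c hc
          rcases cover₂ c with h | h | h
          · rw [hw₂, Pi.sub_apply, hz₂.sum_vanish (fun e => w₁ e) h, ht c h, sub_zero]
          · rw [hw₂, Pi.sub_apply, hz₂.sum_apply (fun e => w₁ e) ⟨c, h⟩, sub_self]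
          · exact absurd h hc
        · intro u hu
          rw [hd]
          exact hz₁.sum_vanish a hu
      rw [h0, map_zero] at hd
      funext e
      rw [← hz₁.sum_apply a e, ← hd]
      rfl
    · intro y
      obtain ⟨⟨c, hc⟩, rfl⟩ := S.mkQ_surjective y
      rw [LinearMap.mem_ker] at hc
      obtain ⟨t, ht⟩ := t₂.exists_matLin_eq c
      set w₁ := c - matLin M₂ t with hw₁
      set w₂ := w₁ - ∑ e : K₁, w₁ e • z₁ e with hw₂
      have hd : matLin M₁ w₂ = 0 := by
        rw [hw₂, map_sub, hz₁.sum_cycle (fun e => w₁ e), hw₁, map_sub, h₁₂, hc]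
        simp
      have h0 : w₂ = 0 := by
        apply t₁.eq_zero_of_support
        · intro c hc
          rcases cover₁ c with h | h | h
          · rw [hw₂, Pi.sub_apply, hz₁.sum_vanish (fun e => w₁ e) h, ht c h, sub_zero]
          · rw [hw₂, Pi.sub_apply, hz₁.sum_apply (fun e => w₁ e) ⟨c, h⟩, sub_self]
          · exact absurd h hc
        · intro u hu
          rw [hd]; rfl
      refine ⟨fun e => w₁ e, ?_⟩
      rw [LinearMap.comp_apply, Submodule.mkQ_apply, Submodule.mkQ_apply, Submodule.Quotient.eq]
      refine ⟨-t, ?_⟩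
      rw [map_neg]
      change _ = ((L fun e => w₁ e : LinearMap.ker (matLin M₁)) : A₁ → ℚ) - c
      rw [hL, ← sub_eq_zero.mp h0, hw₁]
      abel
  rw [← (LinearEquiv.ofBijective _ hbij).finrank_eq, Module.finrank_fintype_fun_eq_card,
    Nat.card_eq_fintype_card]

/-- The face maps on block indices: `face m j` merges the blocks `j` and `j + 1` of `m + 1` blocks
if `j < m`, and the last block with the first one if `j = m`. -/
def face (m j v : ℕ) : ℕ :=
  if j < m then (if v ≤ j then v else v - 1) else (if v = m then 0 else v)

lemma face_face {m i j v : ℕ} (hm : 0 < m) (hj : j < i) (hi : i ≤ m + 1) (hv : v ≤ m + 1) :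
    face m j (face (m + 1) i v) = face m (i - 1) (face (m + 1) j v) := by
  unfold face
  split_ifs <;> omega

lemma face_lt {m j v : ℕ} (hm : 0 < m) (hv : v ≤ m) : face m j v < m := by
  unfold face
  split_ifs <;> omega

lemma exists_face_eq {m j v : ℕ} (hj : j ≤ m) (hv : v < m) : ∃ w, w ≤ m ∧ face m j w = v := by
  unfold face
  by_cases h : v ≤ j
  · exact ⟨v, by omega, by split_ifs <;> omega⟩
  · exact ⟨v + 1, by omega, by split_ifs <;> omega⟩

/-- The condition `P` holds for `f` if it holds for a function vanishing wherever `f` does. -/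
def ZeroMonotone (n : ℕ) (P : (m : ℕ) → (Fin n → Fin m) → Prop) : Prop :=
  ∀ ⦃m m' : ℕ⦄ (f : Fin n → Fin m) (g : Fin n → Fin m'),
    (∀ x : Fin n, (x : ℕ) = 0 → (f x : ℕ) = 0) →
    (∀ x : Fin n, (f x : ℕ) = 0 → (g x : ℕ) = 0) → P m' g → P m f

namespace CycBas

variable {n : ℕ} {P : (m : ℕ) → (Fin n → Fin m) → Prop} {m : ℕ}

/-- The block indices of a face, as natural numbers. -/
def val (f : CycBas n P m) (y : Fin n) : ℕ := f.1 y

lemma val_lt (f : CycBas n P m) (y : Fin n) : f.val y < m := (f.1 y).isLt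

lemma exists_val_eq (f : CycBas n P m) {v : ℕ} (hv : v < m) : ∃ y, f.val y = v := by
  obtain ⟨y, hy⟩ := f.2.1 ⟨v, hv⟩
  exact ⟨y, by simp [val, hy]⟩

lemma val_zero (f : CycBas n P m) {y : Fin n} (hy : (y : ℕ) = 0) : f.val y = 0 := f.2.2.1 y hy

lemma ext_val {f g : CycBas n P m} (h : ∀ y, f.val y = g.val y) : f = g :=
  Subtype.ext (funext fun y => Fin.ext (h y))

lemma exists_of_val (hP : ZeroMonotone n P) {m' : ℕ} (f : CycBas n P m') (F : Fin n → ℕ)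
    (hlt : ∀ y, F y < m) (hsurj : ∀ v < m, ∃ y, F y = v)
    (hzero : ∀ y : Fin n, (y : ℕ) = 0 → F y = 0) (hle : ∀ y, F y = 0 → f.val y = 0) :
    ∃ g : CycBas n P m, ∀ y, g.val y = F y := by
  refine ⟨⟨fun y => ⟨F y, hlt y⟩, fun v => ?_, hzero, hP _ f.1 hzero hle f.2.2.2⟩, fun y => rfl⟩
  obtain ⟨y, hy⟩ := hsurj v v.isLt
  exact ⟨y, Fin.ext hy⟩

end CycBas

open CycBas

section Boundary

variable {n : ℕ} {P : (m : ℕ) → (Fin n → Fin m) → Prop} {m : ℕ}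

lemma cycMat_eq_sum (f : CycBas n P (m + 1)) (g : CycBas n P m) :
    cycMat n P m f g = ∑ j ∈ Finset.range (m + 1),
      (-1 : ℚ) ^ j * (if ∀ y, face m j (f.val y) = g.val y then 1 else 0) := by
  rw [Finset.sum_range_succ, Finset.sum_range, cycMat]
  congr 1
  · refine Finset.sum_congr rfl fun j _ => ?_
    congr 1
    refine if_congr ?_ rfl rfl
    rw [funext_iff]
    refine forall_congr' fun y => ?_
    rw [Fin.ext_iff]
    by_cases h : (f.1 y : ℕ) ≤ j <;> simp [mergeMap, face, val, h]
  · congr 1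
    refine if_congr ?_ rfl rfl
    refine forall_congr' fun y => ?_
    by_cases h : (f.1 y : ℕ) = m <;> simp [face, val, h, eq_comm]

lemma sum_face_mul_face (hP : ZeroMonotone n P) (f : CycBas n P (m + 1 + 1)) (h : CycBas n P m)
    {i j : ℕ} (hi : i ≤ m + 1) :
    (∑ g : CycBas n P (m + 1), (if ∀ y, face (m + 1) i (f.val y) = g.val y then (1 : ℚ) else 0) *
      (if ∀ y, face m j (g.val y) = h.val y then 1 else 0)) =
    if ∀ y, face m j (face (m + 1) i (f.val y)) = h.val y then 1 else 0 := by
  split_ifs with H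
  · obtain ⟨g, hg⟩ : ∃ g : CycBas n P (m + 1), ∀ y, g.val y = face (m + 1) i (f.val y) := by
      refine exists_of_val hP h _ (fun y => face_lt (by omega) (by have := f.val_lt y; omega))
        (fun v hv => ?_) (fun y hy => ?_) (fun y hy => ?_)
      · obtain ⟨w, hw, hwv⟩ := exists_face_eq hi hv
        obtain ⟨y, hy⟩ := f.exists_val_eq (v := w) (by omega)
        exact ⟨y, by rw [hy, hwv]⟩
      · rw [f.val_zero hy]; simp [face]
      · rw [← H y, hy]; simp [face]
    rw [Finset.sum_eq_single g, if_pos (fun y => (hg y).symm), if_pos (fun y => by rw [hg, H])]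
    · norm_num
    · intro g' _ hne
      rw [if_neg, zero_mul]
      exact fun h' => hne (ext_val fun y => by rw [hg, h'])
    · simp
  · refine Finset.sum_eq_zero fun g _ => ?_
    by_cases h1 : ∀ y, face (m + 1) i (f.val y) = g.val y
    · rw [if_neg (c := ∀ y, face m j (g.val y) = h.val y), mul_zero]
      exact fun h2 => H fun y => by rw [h1, h2]
    · rw [if_neg h1, zero_mul]

lemma sum_alternating_eq_zero (m : ℕ) (F : ℕ → ℕ → ℚ)
    (hF : ∀ i j, j < i → i ≤ m + 1 → F i j = F j (i - 1)) :
    ∑ i ∈ Finset.range (m + 1 + 1), ∑ j ∈ Finset.range (m + 1),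
      (-1 : ℚ) ^ i * (-1) ^ j * F i j = 0 := by
  rw [← Finset.sum_product']
  refine Finset.sum_involution
    (fun p _ => if p.2 < p.1 then (p.2, p.1 - 1) else (p.2 + 1, p.1)) ?_ ?_ ?_ ?_
  · rintro ⟨i, j⟩ hp
    simp only [Finset.mem_product, Finset.mem_range] at hp
    dsimp only
    split_ifs with h
    · obtain ⟨i, rfl⟩ : ∃ i', i = i' + 1 := ⟨i - 1, by omega⟩
      rw [hF _ _ h (by omega)]
      simp only [Nat.add_sub_cancel, pow_succ]
      ring
    · rw [hF (j + 1) i (by omega) (by omega)]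
      simp only [Nat.add_sub_cancel, pow_succ]
      ring
  · rintro ⟨i, j⟩ hp _
    by_cases h : j < i
    · simp only [if_pos h, ne_eq, Prod.mk.injEq]
      omega
    · simp only [if_neg h, ne_eq, Prod.mk.injEq]
      omega
  · rintro ⟨i, j⟩ hp
    simp only [Finset.mem_product, Finset.mem_range] at hp ⊢
    by_cases h : j < i
    · simp only [if_pos h]
      omega
    · simp only [if_neg h]
      omega
  · rintro ⟨i, j⟩ hp
    by_cases h : j < i
    · have h' : ¬ i - 1 < j := by omega
      simp only [if_pos h, if_neg h', Prod.mk.injEq]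
      exact ⟨by omega, trivial⟩
    · have h' : i < j + 1 := by omega
      simp only [if_neg h, if_pos h', Prod.mk.injEq]
      exact ⟨trivial, by omega⟩

lemma sum_cycMat_mul_cycMat (hn : 0 < n) (hP : ZeroMonotone n P) (f : CycBas n P (m + 1 + 1))
    (h : CycBas n P m) : ∑ g, cycMat n P (m + 1) f g * cycMat n P m g h = 0 := by
  have hm : 0 < m := lt_of_le_of_lt (Nat.zero_le _) (h.val_lt ⟨0, hn⟩)
  simp only [cycMat_eq_sum, Finset.sum_mul_sum]
  rw [Finset.sum_comm]
  simp only [Finset.sum_comm (s := Finset.univ)]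
  refine Eq.trans ?_ (sum_alternating_eq_zero m
    (fun i j => if ∀ y, face m j (face (m + 1) i (f.val y)) = h.val y then 1 else 0)
    fun i j hji hi => if_congr (forall_congr' fun y => ?_) rfl rfl)
  · refine Finset.sum_congr rfl fun i hi => Finset.sum_congr rfl fun j hj => ?_
    rw [← sum_face_mul_face hP f h (by simpa [Nat.lt_succ_iff] using hi), Finset.mul_sum]
    exact Finset.sum_congr rfl fun g _ => by ring
  · rw [face_face hm hji hi (Nat.lt_succ_iff.mp (f.val_lt y))]

lemma cycBnd_cycBnd (hn : 0 < n) (hP : ZeroMonotone n P) (c : CycBas n P (m + 1 + 1) → ℚ) :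
    cycBnd n P m (cycBnd n P (m + 1) c) = 0 := by
  funext h
  change ∑ g, (∑ f, c f * cycMat n P (m + 1) f g) * cycMat n P m g h = 0
  simp only [Finset.sum_mul]
  rw [Finset.sum_comm]
  refine Finset.sum_eq_zero fun f _ => ?_
  simp only [mul_assoc]
  rw [← Finset.mul_sum, sum_cycMat_mul_cycMat hn hP, mul_zero]

end Boundary

/-- The block of `x` lies strictly before the blocks of all larger vertices outside block `0`. -/
def LowAt {n : ℕ} (F : Fin n → ℕ) (x : Fin n) : Prop := ∀ y, x < y → F y ≠ 0 → F x < F y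

/-- `x` is the least vertex outside block `0` at which `LowAt` fails. -/
structure IsPivot {n : ℕ} (F : Fin n → ℕ) (x : Fin n) : Prop where
  ne_zero : F x ≠ 0
  not_lowAt : ¬ LowAt F x
  lowAt : ∀ y < x, F y ≠ 0 → LowAt F y

/-- Move `x` out of its block into a new block directly after it. -/
def splitAt {n : ℕ} (F : Fin n → ℕ) (x y : Fin n) : ℕ :=
  if y = x then F x + 1 else if F x < F y then F y + 1 else F y

namespace IsPivot

variable {n : ℕ} {F G : Fin n → ℕ} {x x' : Fin n}

lemma le_of_not_lowAt (h : IsPivot F x) (h0 : F x' ≠ 0) (h1 : ¬ LowAt F x') : x ≤ x' := by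
  by_contra hlt
  exact h1 (h.lowAt x' (not_le.mp hlt) h0)

lemma eq (h : IsPivot F x) (h' : IsPivot F x') : x = x' :=
  le_antisymm (h.le_of_not_lowAt h'.ne_zero h'.not_lowAt)
    (h'.le_of_not_lowAt h.ne_zero h.not_lowAt)

lemma exists_of_not_lowAt (h0 : F x ≠ 0) (h1 : ¬ LowAt F x) : ∃ x', IsPivot F x' := by
  obtain ⟨z, hz, hmin⟩ := WellFounded.has_min (wellFounded_lt (α := Fin n))
    {y | F y ≠ 0 ∧ ¬ LowAt F y} ⟨x, h0, h1⟩
  exact ⟨z, hz.1, hz.2, fun y hy hy0 => by_contra fun hl => hmin y ⟨hy0, hl⟩ hy⟩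

end IsPivot

section Matching

variable {n : ℕ} {P : (m : ℕ) → (Fin n → Fin m) → Prop} {m : ℕ}

/-- Faces in which the pivot shares its block with another vertex. -/
def splittable (n : ℕ) (P : (m : ℕ) → (Fin n → Fin m) → Prop) (m : ℕ) : Set (CycBas n P m) :=
  {f | ∃ x, IsPivot f.val x ∧ ∃ y, y ≠ x ∧ f.val y = f.val x}

/-- Faces without pivot. -/
def increasing (n : ℕ) (P : (m : ℕ) → (Fin n → Fin m) → Prop) (m : ℕ) : Set (CycBas n P m) :=
  {f | ∀ x, f.val x ≠ 0 → LowAt f.val x}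

lemma exists_split (hP : ZeroMonotone n P) (u : splittable n P m) :
    ∃ w : CycBas n P (m + 1), ∀ x, IsPivot u.1.val x → ∀ y, w.val y = splitAt u.1.val x y := by
  obtain ⟨u, x, hx, z, hzx, hz⟩ := u
  have hx0 := hx.ne_zero
  obtain ⟨w, hw⟩ : ∃ w : CycBas n P (m + 1), ∀ y, w.val y = splitAt u.val x y := by
    refine exists_of_val hP u _ (fun y => ?_) (fun v hv => ?_) (fun y hy => ?_) (fun y hy => ?_)
    · have h1 := u.val_lt x
      have h2 := u.val_lt y
      unfold splitAt
      split_ifs <;> omega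
    · rcases lt_trichotomy v (u.val x + 1) with h | h | h
      · by_cases hvx : v = u.val x
        · exact ⟨z, by rw [splitAt, if_neg hzx, if_neg (by omega), hz, hvx]⟩
        · obtain ⟨y, hy⟩ := u.exists_val_eq (v := v) (by have := u.val_lt x; omega)
          exact ⟨y, by rw [splitAt, if_neg (by rintro rfl; exact hvx hy.symm),
            if_neg (by omega), hy]⟩
      · exact ⟨x, by rw [splitAt, if_pos rfl, h]⟩
      · obtain ⟨y, hy⟩ := u.exists_val_eq (v := v - 1) (by omega)
        exact ⟨y, by rw [splitAt, if_neg (by rintro rfl; omega), if_pos (by omega)]; omega⟩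
    · have h0 := u.val_zero hy
      rw [splitAt, if_neg (by rintro rfl; exact hx0 h0), if_neg (by omega), h0]
    · unfold splitAt at hy
      split_ifs at hy
      exact hy
  exact ⟨w, fun x' hx' => hx.eq hx' ▸ hw⟩

/-- The face obtained by moving the pivot into a block of its own. -/
noncomputable def splitFace (hP : ZeroMonotone n P) (u : splittable n P m) : CycBas n P (m + 1) :=
  (exists_split hP u).choose

lemma splitFace_val (hP : ZeroMonotone n P) (u : splittable n P m) {x : Fin n}
    (hx : IsPivot u.1.val x) (y : Fin n) : (splitFace hP u).val y = splitAt u.1.val x y :=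
  (exists_split hP u).choose_spec x hx y

/-- The pivot of a splittable face. -/
noncomputable def pivot (u : splittable n P m) : Fin n := u.2.choose

lemma isPivot_pivot (u : splittable n P m) : IsPivot u.1.val (pivot u) := u.2.choose_spec.1

lemma exists_ne_pivot (u : splittable n P m) :
    ∃ y, y ≠ pivot u ∧ u.1.val y = u.1.val (pivot u) := u.2.choose_spec.2

lemma face_splitFace_self (hP : ZeroMonotone n P) (u : splittable n P m) (y : Fin n) :
    face m (u.1.val (pivot u)) ((splitFace hP u).val y) = u.1.val y := by
  rw [splitFace_val hP u (isPivot_pivot u)]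
  have h1 := u.1.val_lt (pivot u)
  unfold face splitAt
  by_cases hy : y = pivot u
  · subst hy
    simp [h1]
  · split_ifs <;> omega

lemma eq_of_face_splitFace (hP : ZeroMonotone n P) (u : splittable n P m) {j : ℕ} (hj : j ≤ m)
    (h : ∀ y, face m j ((splitFace hP u).val y) = u.1.val y) : j = u.1.val (pivot u) := by
  have h1 := u.1.val_lt (pivot u)
  have h2 := (isPivot_pivot u).ne_zero
  have key : ∀ v < m + 1, face m j v = face m (u.1.val (pivot u)) v := by
    intro v hv
    obtain ⟨y, rfl⟩ := (splitFace hP u).exists_val_eq hv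
    rw [h, face_splitFace_self]
  have k1 := key m (by omega)
  have k2 := key (j + 1)
  have k3 := key (u.1.val (pivot u) + 1) (by omega)
  unfold face at k1 k2 k3
  split_ifs at k1 k2 k3 <;> omega

lemma cycMat_splitFace_self_ne_zero (hP : ZeroMonotone n P) (u : splittable n P m) :
    cycMat n P m (splitFace hP u) u ≠ 0 := by
  have h1 := u.1.val_lt (pivot u)
  rw [cycMat_eq_sum, Finset.sum_eq_single (u.1.val (pivot u)),
    if_pos (face_splitFace_self hP u)]
  · simp
  · intro j hj hne
    rw [if_neg, mul_zero]
    exact fun h => hne (eq_of_face_splitFace hP u (by simpa [Nat.lt_succ_iff] using hj) h)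
  · intro h
    exact absurd (Finset.mem_range.mpr (by omega)) h

/-- The potential with respect to which the matching is triangular. -/
noncomputable def potential (u : splittable n P m) : ℕ ×ₗ ℕ ×ₗ ℕ :=
  toLex ((Finset.univ.filter fun y => u.1.val y ≠ 0).card,
    toLex ((pivot u : ℕ), m - u.1.val (pivot u)))

lemma potential_lt (hP : ZeroMonotone n P) (u u' : splittable n P m) (hne : u' ≠ u) {j : ℕ}
    (hj : j ≤ m) (h : ∀ y, face m j ((splitFace hP u).val y) = u'.1.val y) :
    potential u' < potential u := by
  set x := pivot u with hx
  have hpx : IsPivot u.1.val x := isPivot_pivot u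
  have hx0 := hpx.ne_zero
  have hxm := u.1.val_lt x
  have hw := splitFace_val hP u hpx
  have hw0 : ∀ y, (splitFace hP u).val y = 0 → u.1.val y = 0 := by
    intro y hy
    rw [hw, splitAt] at hy
    split_ifs at hy
    exact hy
  have hw0' : ∀ y, u.1.val y = 0 → (splitFace hP u).val y = 0 := by
    intro y hy
    rw [hw, splitAt, if_neg (by rintro rfl; exact hx0 hy), if_neg (by omega), hy]
  unfold potential
  rw [Prod.Lex.toLex_lt_toLex]
  by_cases hj' : 0 < j ∧ j < m
  · right
    have hsupp : ∀ y, u'.1.val y = 0 ↔ u.1.val y = 0 := by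
      intro y
      constructor
      · intro hy
        apply hw0
        rw [← h] at hy
        unfold face at hy
        split_ifs at hy <;> omega
      · intro hy
        rw [← h, hw0' y hy]
        simp [face]
    refine ⟨by simp only [ne_eq, hsupp], ?_⟩
    obtain ⟨hj0, hjm⟩ := hj'
    obtain ⟨z, hzx, hz⟩ : ∃ z, z ≠ x ∧ u.1.val z = u.1.val x := exists_ne_pivot u
    have hxz : x < z := by
      rcases lt_or_gt_of_ne hzx with hlt | hlt
      · have := hpx.lowAt z hlt (by omega) x hlt hx0
        omega
      · exact hlt
    have hwx : (splitFace hP u).val x = u.1.val x + 1 := by rw [hw, splitAt, if_pos rfl]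
    have hwz : (splitFace hP u).val z = u.1.val x := by
      rw [hw, splitAt, if_neg hzx, if_neg (by omega), hz]
    have hle : pivot u' ≤ x := by
      apply (isPivot_pivot u').le_of_not_lowAt
      · rw [Ne, hsupp]; exact hx0
      · intro hl
        have := hl z hxz (by rw [Ne, hsupp]; omega)
        rw [← h, ← h, hwx, hwz] at this
        unfold face at this
        split_ifs at this <;> omega
    rw [Prod.Lex.toLex_lt_toLex]
    rcases lt_or_eq_of_le hle with hlt | heq
    · exact Or.inl hlt
    right
    refine ⟨by rw [heq], ?_⟩
    dsimp only
    rw [heq, ← hx]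
    have hu'm := u'.1.val_lt x
    obtain ⟨y, hyx, hy⟩ : ∃ y, y ≠ x ∧ u'.1.val y = u'.1.val x :=
      heq ▸ exists_ne_pivot u'
    have hwy : (splitFace hP u).val y ≠ u.1.val x + 1 := by
      rw [hw, splitAt, if_neg hyx]
      split_ifs <;> omega
    have hj1 : j ≠ u.1.val x := by
      rintro rfl
      apply hne
      refine Subtype.ext (ext_val fun y => ?_)
      rw [← h, face_splitFace_self]
    have e1 := h x
    have e2 := h y
    rw [hwx] at e1
    rw [hy, ← e1] at e2
    suffices u.1.val x < u'.1.val x by omega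
    rw [← e1]
    unfold face at e2 ⊢
    split_ifs at e2 ⊢ <;> omega
  · left
    dsimp only
    apply Finset.card_lt_card
    rw [Finset.ssubset_iff_of_subset]
    · obtain ⟨y, hy⟩ := (splitFace hP u).exists_val_eq (v := if j = 0 then 1 else m)
        (by split_ifs <;> omega)
      refine ⟨y, ?_, ?_⟩
      · simp only [Finset.mem_filter, Finset.mem_univ, true_and]
        intro h0
        rw [hw0' y h0] at hy
        split_ifs at hy
        omega
      · simp only [Finset.mem_filter, Finset.mem_univ, true_and, not_not]
        rw [← h, hy]
        unfold face
        split_ifs <;> omega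
    · intro y hy
      simp only [Finset.mem_filter, Finset.mem_univ, true_and] at hy ⊢
      intro h0
      apply hy
      rw [← h, hw0' y h0]
      simp [face]

lemma triangularMatching_splitFace (hP : ZeroMonotone n P) :
    TriangularMatching (cycMat n P m) (splittable n P m) (splitFace hP) := by
  refine ⟨cycMat_splitFace_self_ne_zero hP, potential, fun u u' hne h => ?_⟩
  rw [cycMat_eq_sum] at h
  obtain ⟨j, hj, hj'⟩ := Finset.exists_ne_zero_of_sum_ne_zero h
  refine potential_lt hP u u' hne (by simpa [Nat.lt_succ_iff] using hj) ?_
  by_contra hc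
  exact hj' (by rw [if_neg hc, mul_zero])

lemma mem_range_splitFace (hP : ZeroMonotone n P) (w : CycBas n P (m + 1)) {x : Fin n}
    (hx : IsPivot w.val x) (hs : ∀ y, y ≠ x → w.val y ≠ w.val x) :
    w ∈ Set.range (splitFace (m := m) hP) := by
  have hx0 := hx.ne_zero
  obtain ⟨z, hz⟩ : ∃ z, x < z ∧ w.val z ≠ 0 ∧ w.val z ≤ w.val x := by
    have := hx.not_lowAt
    unfold LowAt at this
    push Not at this
    exact this
  have hzx := hs z hz.1.ne'
  have hwm := w.val_lt x
  obtain ⟨y, hy⟩ := w.exists_val_eq (v := w.val x - 1) (by omega)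
  have hxy : x < y := by
    rcases lt_trichotomy y x with hlt | rfl | hlt
    · have := hx.lowAt y hlt (by omega) z (hlt.trans hz.1) hz.2.1
      omega
    · omega
    · exact hlt
  obtain ⟨u, hu⟩ : ∃ u : CycBas n P m, ∀ y, u.val y = face m (w.val x - 1) (w.val y) := by
    refine exists_of_val hP w _ (fun y => face_lt (by omega) (Nat.lt_succ_iff.mp (w.val_lt y)))
      (fun v hv => ?_) (fun y hy => ?_) (fun y hy => ?_)
    · obtain ⟨b, hb, hbv⟩ := exists_face_eq (m := m) (j := w.val x - 1) (by omega) hv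
      obtain ⟨y, hy⟩ := w.exists_val_eq (v := b) (by omega)
      exact ⟨y, by rw [hy, hbv]⟩
    · rw [w.val_zero hy]; simp [face]
    · unfold face at hy
      split_ifs at hy <;> omega
  have hface : ∀ v, face m (w.val x - 1) v = if v ≤ w.val x - 1 then v else v - 1 := by
    intro v
    rw [face, if_pos (by omega)]
  have hux : u.val x = w.val x - 1 := by rw [hu, hface, if_neg (by omega)]
  have huy : u.val y = w.val x - 1 := by rw [hu, hface, if_pos (by omega), hy]
  have hpu : IsPivot u.val x := by
    refine ⟨by omega, fun hl => ?_, fun a ha ha0 b hb hb0 => ?_⟩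
    · have := hl y hxy (by omega)
      omega
    · have hwa : w.val a ≠ 0 := by
        intro h0
        rw [hu, h0] at ha0
        simp [face] at ha0
      have hwb : w.val b ≠ 0 := by
        intro h0
        rw [hu, h0] at hb0
        simp [face] at hb0
      have h1 := hx.lowAt a ha hwa b hb hwb
      have h2 := hx.lowAt a ha hwa z (ha.trans hz.1) hz.2.1
      rw [hu, hu, hface, hface]
      split_ifs <;> omega
  refine ⟨⟨u, x, hpu, y, hxy.ne', by omega⟩, ext_val fun a => ?_⟩
  rw [splitFace_val hP _ hpu]
  dsimp only
  rw [splitAt]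
  split_ifs with h1 h2
  · subst h1; omega
  · rw [hux, hu, hface] at h2
    rw [hu, hface]
    split_ifs at h2 ⊢ <;> omega
  · have := hs a h1
    rw [hux, hu, hface] at h2
    rw [hu, hface]
    split_ifs at h2 ⊢ <;> omega

lemma splittable_or_increasing_or_range (hP : ZeroMonotone n P) (w : CycBas n P (m + 1)) :
    w ∈ splittable n P (m + 1) ∨ w ∈ increasing n P (m + 1) ∨
      w ∈ Set.range (splitFace (m := m) hP) := by
  by_cases hK : w ∈ increasing n P (m + 1)
  · exact Or.inr (Or.inl hK)
  obtain ⟨y, hy⟩ := not_forall.mp hK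
  obtain ⟨hy0, hy⟩ := Classical.not_imp.mp hy
  obtain ⟨x, hx⟩ := IsPivot.exists_of_not_lowAt hy0 hy
  by_cases hs : ∃ y, y ≠ x ∧ w.val y = w.val x
  · exact Or.inl ⟨x, hx, hs⟩
  · push Not at hs
    exact Or.inr (Or.inr (mem_range_splitFace hP w hx hs))

end Matching

section Cycles

variable {n : ℕ} {P : (m : ℕ) → (Fin n → Fin m) → Prop} {m : ℕ}

/-- The permutation `σ` acting on the blocks other than block `0`. -/
def liftPerm (σ : Equiv.Perm (Fin m)) : Fin (m + 1) → Fin (m + 1) :=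
  Fin.cases 0 fun i => (σ i).succ

@[simp] lemma liftPerm_zero (σ : Equiv.Perm (Fin m)) : liftPerm σ 0 = 0 := rfl

@[simp] lemma liftPerm_succ (σ : Equiv.Perm (Fin m)) (i : Fin m) :
    liftPerm σ i.succ = (σ i).succ := rfl

lemma liftPerm_mul (σ τ : Equiv.Perm (Fin m)) (v : Fin (m + 1)) :
    liftPerm (σ * τ) v = liftPerm σ (liftPerm τ v) := by
  cases v using Fin.cases <;> simp

lemma liftPerm_inv (σ : Equiv.Perm (Fin m)) (v : Fin (m + 1)) :
    liftPerm σ (liftPerm σ⁻¹ v) = v := by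
  cases v using Fin.cases <;> simp

lemma liftPerm_injective (σ : Equiv.Perm (Fin m)) : Injective (liftPerm σ) := by
  intro v w h
  have := congrArg (liftPerm σ⁻¹) h
  have key : ∀ v, liftPerm σ⁻¹ (liftPerm σ v) = v := fun v => by
    simpa using liftPerm_inv σ⁻¹ v
  rwa [key, key] at this

lemma liftPerm_eq_zero (σ : Equiv.Perm (Fin m)) (v : Fin (m + 1)) : liftPerm σ v = 0 ↔ v = 0 := by
  cases v using Fin.cases <;> simp

/-- Permute the blocks other than block `0`. -/
def permFace (hP : ZeroMonotone n P) (σ : Equiv.Perm (Fin m)) (f : CycBas n P (m + 1)) :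
    CycBas n P (m + 1) :=
  ⟨fun y => liftPerm σ (f.1 y), fun v => by
      obtain ⟨y, hy⟩ := f.2.1 (liftPerm σ⁻¹ v)
      exact ⟨y, by simp only [hy, liftPerm_inv]⟩,
    fun y hy => by
      have : f.1 y = 0 := Fin.ext (f.2.2.1 y hy)
      simp [this],
    hP _ f.1 (fun y hy => by
      have : f.1 y = 0 := Fin.ext (f.2.2.1 y hy)
      simp [this]) (fun y hy => by
      have : f.1 y = 0 := (liftPerm_eq_zero σ _).mp (Fin.ext hy)
      simp [this]) f.2.2.2⟩

lemma permFace_val (hP : ZeroMonotone n P) (σ : Equiv.Perm (Fin m)) (f : CycBas n P (m + 1))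
    (y : Fin n) : (permFace hP σ f).val y = liftPerm σ (f.1 y) := rfl

lemma permFace_val_eq_iff (hP : ZeroMonotone n P) (σ : Equiv.Perm (Fin m))
    (f : CycBas n P (m + 1)) (x y : Fin n) :
    (permFace hP σ f).val x = (permFace hP σ f).val y ↔ f.val x = f.val y := by
  rw [permFace_val, permFace_val, ← Fin.ext_iff, (liftPerm_injective σ).eq_iff, Fin.ext_iff]
  rfl

lemma permFace_val_eq_zero (hP : ZeroMonotone n P) (σ : Equiv.Perm (Fin m))
    (f : CycBas n P (m + 1)) (x : Fin n) : (permFace hP σ f).val x = 0 ↔ f.val x = 0 := by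
  have := liftPerm_eq_zero σ (f.1 x)
  rwa [Fin.ext_iff, Fin.ext_iff] at this

/-- The antisymmetrization of a face over the permutations of the blocks other than block `0`. -/
noncomputable def permCycle (hP : ZeroMonotone n P) (f : CycBas n P (m + 1)) :
    CycBas n P (m + 1) → ℚ :=
  ∑ σ : Equiv.Perm (Fin m), ((Equiv.Perm.sign σ : ℤ) : ℚ) • Pi.single (permFace hP σ f) 1

lemma permCycle_apply (hP : ZeroMonotone n P) (f g : CycBas n P (m + 1)) :
    permCycle hP f g = ∑ σ : Equiv.Perm (Fin m),
      ((Equiv.Perm.sign σ : ℤ) : ℚ) * (if g = permFace hP σ f then 1 else 0) := by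
  simp [permCycle, Pi.single_apply]

/-- The part of the coefficient of `g` in the boundary of `permCycle hP f` due to the face map
`face m j`. -/
noncomputable def permCycleFace (hP : ZeroMonotone n P) (f : CycBas n P (m + 1)) (g : CycBas n P m)
    (j : ℕ) : ℚ :=
  ∑ σ : Equiv.Perm (Fin m), ((Equiv.Perm.sign σ : ℤ) : ℚ) *
    (if ∀ y, face m j ((permFace hP σ f).val y) = g.val y then 1 else 0)

lemma permCycleFace_eq (hP : ZeroMonotone n P) (f : CycBas n P (m + 1)) (g : CycBas n P m)
    (τ : Equiv.Perm (Fin m)) {i j : ℕ}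
    (h : ∀ v : Fin (m + 1), face m i (liftPerm τ v) = face m j v) :
    permCycleFace hP f g i = ((Equiv.Perm.sign τ : ℤ) : ℚ) * permCycleFace hP f g j := by
  unfold permCycleFace
  rw [← Equiv.sum_comp (Equiv.mulLeft τ), Finset.mul_sum]
  refine Finset.sum_congr rfl fun σ _ => ?_
  rw [Equiv.coe_mulLeft, Equiv.Perm.sign_mul, ← mul_assoc]
  congr 1
  · push_cast
    rfl
  · exact if_congr (forall_congr' fun y => by
      rw [permFace_val, permFace_val, liftPerm_mul, h]) rfl rfl

lemma permCycleFace_eq_zero (hP : ZeroMonotone n P) (f : CycBas n P (m + 1)) (g : CycBas n P m)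
    {j : ℕ} (h0 : 0 < j) (hj : j < m) : permCycleFace hP f g j = 0 := by
  have hne : (⟨j - 1, by omega⟩ : Fin m) ≠ ⟨j, hj⟩ := by
    rw [Ne, Fin.mk.injEq]; omega
  have key := permCycleFace_eq hP f g (Equiv.swap ⟨j - 1, by omega⟩ ⟨j, hj⟩) (i := j) (j := j) ?_
  · rw [Equiv.Perm.sign_swap hne] at key
    push_cast at key
    linarith
  · intro v
    cases v using Fin.cases with
    | zero => rw [liftPerm_zero]
    | succ v =>
      rw [liftPerm_succ, Equiv.swap_apply_def]
      simp only [Fin.ext_iff]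
      unfold face
      split_ifs <;> simp_all <;> omega

lemma permCycleFace_zero (hP : ZeroMonotone n P) (f : CycBas n P (m + 1 + 1))
    (g : CycBas n P (m + 1)) :
    permCycleFace hP f g 0 = (-1) ^ m * permCycleFace hP f g (m + 1) := by
  rw [permCycleFace_eq hP f g (finRotate (m + 1)) (i := 0) (j := m + 1), sign_finRotate]
  · push_cast
    rfl
  · intro v
    cases v using Fin.cases with
    | zero => simp [face]
    | succ v =>
      rw [liftPerm_succ, Fin.val_succ, Fin.val_succ, coe_finRotate]
      simp only [Fin.ext_iff, Fin.val_last]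
      have := v.isLt
      unfold face
      split_ifs <;> omega

lemma matLin_permCycle (hn : 0 < n) (hP : ZeroMonotone n P) (f : CycBas n P (m + 1)) :
    matLin (cycMat n P m) (permCycle hP f) = 0 := by
  funext g
  have hm : 0 < m := lt_of_le_of_lt (Nat.zero_le _) (g.val_lt ⟨0, hn⟩)
  have hsingle : ∀ f', matLin (cycMat n P m) (Pi.single f' 1) g = cycMat n P m f' g := by
    intro f'
    change ∑ a, _ = _
    simp [Pi.single_apply]
  have hsum : matLin (cycMat n P m) (permCycle hP f) g =
      ∑ j ∈ Finset.range (m + 1), (-1) ^ j * permCycleFace hP f g j := by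
    simp only [permCycle, permCycleFace, map_sum, map_smul, Finset.sum_apply, Pi.smul_apply, hsingle,
      smul_eq_mul, cycMat_eq_sum, Finset.mul_sum]
    rw [Finset.sum_comm]
    exact Finset.sum_congr rfl fun j _ => Finset.sum_congr rfl fun σ _ => by
      rw [← mul_assoc, ← mul_assoc, mul_comm (_ : ℚ) ((-1) ^ j)]
  rw [hsum]
  obtain ⟨m, rfl⟩ : ∃ m', m = m' + 1 := ⟨m - 1, by omega⟩
  rw [Finset.sum_range_succ, Finset.sum_range_succ', Finset.sum_eq_zero, permCycleFace_zero]
  · simp only [Pi.zero_apply, pow_succ]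
    ring
  · intro j hj
    rw [permCycleFace_eq_zero hP f g (by omega) (by simpa using hj), mul_zero]

lemma eq_of_mem_increasing {e : CycBas n P m} (he : e ∈ increasing n P m) {x y : Fin n}
    (hx : e.val x ≠ 0) (h : e.val x = e.val y) : x = y := by
  rcases lt_trichotomy x y with hlt | rfl | hlt
  · have := he x hx y hlt (h ▸ hx)
    omega
  · rfl
  · have := he y (h ▸ hx) x hlt hx
    omega

lemma val_not_lt_of_mem_increasing {e e' : CycBas n P m} (he : e ∈ increasing n P m)
    (he' : e' ∈ increasing n P m) (h : ∀ x, e.val x = 0 ↔ e'.val x = 0) (y : Fin n)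
    (hy : ∀ x < y, e.val x = e'.val x) : ¬ e.val y < e'.val y := by
  intro hlt
  have hy0 : e.val y ≠ 0 := by rw [Ne, h]; omega
  obtain ⟨z, hz⟩ := e'.exists_val_eq (e.val_lt y)
  rcases lt_trichotomy z y with hzy | rfl | hzy
  · have := eq_of_mem_increasing he hy0 (y := z) (by rw [hy z hzy, hz])
    omega
  · omega
  · have := he' y (by omega) z hzy (by omega)
    omega

lemma eq_of_val_eq_zero_iff {e e' : CycBas n P m} (he : e ∈ increasing n P m)
    (he' : e' ∈ increasing n P m) (h : ∀ x, e.val x = 0 ↔ e'.val x = 0) : e = e' := by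
  refine ext_val fun y => ?_
  induction y using WellFoundedLT.induction with
  | ind y ih =>
    exact le_antisymm
      (not_lt.mp (val_not_lt_of_mem_increasing he' he (fun x => (h x).symm) y
        fun x hx => (ih x hx).symm))
      (not_lt.mp (val_not_lt_of_mem_increasing he he' h y ih))

lemma dualCycles_permCycle (hn : 0 < n) (hP : ZeroMonotone n P) :
    DualCycles (cycMat n P m) (splittable n P (m + 1)) (increasing n P (m + 1))
      (fun e => permCycle hP e.1) where
  cycle e := matLin_permCycle hn hP e.1
  vanish e u hu := by
    obtain ⟨x, hx, y, hyx, hy⟩ := hu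
    rw [permCycle_apply]
    refine Finset.sum_eq_zero fun σ _ => ?_
    rw [if_neg, mul_zero]
    rintro rfl
    have hx0 := hx.ne_zero
    rw [Ne, permFace_val_eq_zero] at hx0
    rw [permFace_val_eq_iff] at hy
    exact hyx (eq_of_mem_increasing e.2 hx0 hy.symm).symm
  diag e := by
    rw [permCycle_apply, Finset.sum_eq_single 1]
    · rw [if_pos]
      · simp
      · refine ext_val fun y => ?_
        rw [permFace_val, val]
        congr 1
        cases e.1.1 y using Fin.cases <;> simp
    · intro σ _ hσ
      rw [if_neg, mul_zero]
      intro h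
      apply hσ
      ext i
      obtain ⟨y, hy⟩ := e.1.2.1 i.succ
      have := congrFun (congrArg Subtype.val h) y
      change e.1.1 y = liftPerm σ (e.1.1 y) at this
      rw [hy, liftPerm_succ, Fin.succ_inj] at this
      rw [← this, Equiv.Perm.one_apply]
    · simp
  off_diag e e' hne := by
    rw [permCycle_apply]
    refine Finset.sum_eq_zero fun σ _ => ?_
    rw [if_neg, mul_zero]
    intro h
    apply hne
    refine Subtype.ext (eq_of_val_eq_zero_iff e'.2 e.2 fun x => ?_)
    rw [h, permFace_val_eq_zero]

theorem finrank_homologyOf_cycBnd (hn : 0 < n) (hP : ZeroMonotone n P) (q : ℕ) :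
    Module.finrank ℚ (homologyOf (cycBnd n P (q + 1)) (cycBnd n P q)) =
      Nat.card (increasing n P (q + 1)) :=
  finrank_homologyOf_eq_card (cycBnd_cycBnd hn hP) (cycBnd_cycBnd hn hP)
    (triangularMatching_splitFace hP) (triangularMatching_splitFace hP)
    (triangularMatching_splitFace hP) (dualCycles_permCycle hn hP) (dualCycles_permCycle hn hP)
    (splittable_or_increasing_or_range hP) (splittable_or_increasing_or_range hP)

end Cycles

section Star

variable {n k : ℕ}

lemma zeroMonotone_starFree (hn : 0 < n) : ZeroMonotone n (starFree n k) := by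
  intro m m' f g hf hfg hg e he h0 i
  by_contra! hc
  have h0e : (⟨0, hn⟩ : Fin n) ∈ e := h0 _ rfl
  have hi : (i : ℕ) = 0 := by rw [← hc _ h0e, hf _ rfl]
  have hz : ∀ x ∈ e, (g x : ℕ) = 0 := fun x hx => hfg x (by rw [hc x hx, hi])
  obtain ⟨x, hx, hne⟩ := hg e he h0 (g ⟨0, hn⟩)
  exact hne (Fin.ext (by rw [hz x hx, hz _ h0e]))

lemma starFree_iff (hn : 0 < n) (hk : 0 < k) {m : ℕ} (f : Fin n → Fin m)
    (hf : ∀ x : Fin n, (x : ℕ) = 0 → (f x : ℕ) = 0) :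
    starFree n k m f ↔ (Finset.univ.filter fun y => (f y : ℕ) = 0).card < k := by
  constructor
  · intro h
    by_contra! hc
    obtain ⟨e, h0e, hle, he⟩ := Finset.exists_subsuperset_card_eq
      (s := {(⟨0, hn⟩ : Fin n)}) (t := Finset.univ.filter fun y => (f y : ℕ) = 0) (n := k)
      (by simp [hf]) (by rw [Finset.card_singleton]; exact hk) hc
    obtain ⟨x, hx, hne⟩ := h e he (fun x hx => h0e (by simpa [Fin.ext_iff] using hx)) (f ⟨0, hn⟩)
    have hx0 := hle hx
    simp only [Finset.mem_filter, Finset.mem_univ, true_and] at hx0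
    exact hne (Fin.ext (by rw [hx0, hf _ rfl]))
  · intro h e he h0 i
    by_contra! hc
    have hi : (i : ℕ) = 0 := by rw [← hc _ (h0 ⟨0, hn⟩ rfl), hf _ rfl]
    refine absurd (Finset.card_le_card (s := e) fun x hx => ?_) (not_le.mpr (he ▸ h))
    simp [hc x hx, hi]

lemma card_val_ne_zero {P : (m : ℕ) → (Fin n → Fin m) → Prop} {q : ℕ} {e : CycBas n P (q + 1)}
    (he : e ∈ increasing n P (q + 1)) :
    (Finset.univ.filter fun y => e.val y ≠ 0).card = q := by
  have himage : (Finset.univ.filter fun y => e.val y ≠ 0).image e.val = Finset.Icc 1 q := by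
    ext v
    simp only [Finset.mem_image, Finset.mem_filter, Finset.mem_univ, true_and, Finset.mem_Icc]
    constructor
    · rintro ⟨y, hy, rfl⟩
      have := e.val_lt y
      omega
    · intro hv
      obtain ⟨y, hy⟩ := e.exists_val_eq (v := v) (by omega)
      exact ⟨y, by omega, hy⟩
  rw [← Finset.card_image_of_injOn (f := e.val), himage, Nat.card_Icc, Nat.add_sub_cancel]
  intro x hx y _ hxy
  exact eq_of_mem_increasing he (by simpa using hx) hxy

lemma exists_increasing (hn : 0 < n) (hk : 0 < k) {S : Finset (Fin n)}
    (h0 : ∀ x ∈ S, (x : ℕ) ≠ 0) (hS : n - S.card < k) :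
    ∃ e ∈ increasing n (starFree n k) (S.card + 1), ∀ y, e.val y ≠ 0 ↔ y ∈ S := by
  let iso := S.orderIsoOfFin rfl
  let F : Fin n → ℕ := fun y => if h : y ∈ S then iso.symm ⟨y, h⟩ + 1 else 0
  have hF : ∀ y, F y ≠ 0 ↔ y ∈ S := by
    intro y
    by_cases h : y ∈ S <;> simp [F, h]
  have hlt : ∀ y, F y < S.card + 1 := by
    intro y
    by_cases h : y ∈ S
    · simp only [F, dif_pos h]
      have := (iso.symm ⟨y, h⟩).isLt
      omega
    · simp [F, h]
  have hz : ∀ y : Fin n, (y : ℕ) = 0 → F y = 0 := by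
    intro y hy
    by_contra hne
    exact h0 y ((hF y).mp hne) hy
  refine ⟨⟨fun y => ⟨F y, hlt y⟩, fun v => ?_, hz, (starFree_iff hn hk _ hz).mpr ?_⟩, ?_, hF⟩
  · cases v using Fin.cases with
    | zero => exact ⟨⟨0, hn⟩, Fin.ext (hz _ rfl)⟩
    | succ v => exact ⟨iso v, Fin.ext (by simp [F])⟩
  · have : (Finset.univ.filter fun y => F y = 0) = Sᶜ := by
      ext y
      simp [← hF]
    change (Finset.univ.filter fun y => F y = 0).card < k
    rwa [this, Finset.card_compl, Fintype.card_fin]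
  · intro x hx y hxy hy
    change F x < F y
    have hxS := (hF x).mp hx
    have hyS := (hF y).mp hy
    simp only [F, dif_pos hxS, dif_pos hyS, Nat.add_lt_add_iff_right, Fin.val_fin_lt,
      OrderIso.lt_iff_lt]
    exact hxy

lemma card_increasing_starFree (hn : 0 < n) (hk : 0 < k) {q : ℕ} (hq : n - q < k) :
    Nat.card (increasing n (starFree n k) (q + 1)) = (n - 1).choose q := by
  have hcard : (Finset.univ.filter fun y : Fin n => (y : ℕ) ≠ 0).card = n - 1 := by
    have : (Finset.univ.filter fun y : Fin n => (y : ℕ) ≠ 0) = {⟨0, hn⟩}ᶜ := by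
      ext y
      simp [Fin.ext_iff]
    rw [this, Finset.card_compl, Fintype.card_fin, Finset.card_singleton]
  rw [← hcard, ← Finset.card_powersetCard, ← Nat.card_eq_finsetCard]
  refine Nat.card_eq_of_bijective (fun e => ⟨Finset.univ.filter fun y => e.1.val y ≠ 0, ?_⟩)
    ⟨fun e e' h => ?_, fun S => ?_⟩
  · rw [Finset.mem_powersetCard]
    refine ⟨fun y hy => ?_, card_val_ne_zero e.2⟩
    simp only [Finset.mem_filter, Finset.mem_univ, true_and] at hy ⊢
    exact fun h0 => hy (e.1.val_zero h0)
  · refine Subtype.ext (eq_of_val_eq_zero_iff e.2 e'.2 fun x => ?_)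
    have := Finset.ext_iff.mp (Subtype.mk.inj h) x
    simp only [Finset.mem_filter, Finset.mem_univ, true_and] at this
    exact not_iff_not.mp this
  · obtain ⟨S, hS⟩ := S
    obtain ⟨hsub, rfl⟩ := Finset.mem_powersetCard.mp hS
    obtain ⟨e, he, heS⟩ := exists_increasing hn hk
      (fun x hx => (Finset.mem_filter.mp (hsub hx)).2) hq
    refine ⟨⟨e, he⟩, Subtype.ext (Finset.ext fun y => ?_)⟩
    simp [← heS]

lemma card_increasing_starFree_eq_zero (hn : 0 < n) (hk : 0 < k) {q : ℕ} (hq : q + k ≤ n) :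
    Nat.card (increasing n (starFree n k) (q + 1)) = 0 := by
  have : IsEmpty (increasing n (starFree n k) (q + 1)) := by
    refine ⟨fun ⟨e, he⟩ => ?_⟩
    have h1 := (starFree_iff hn hk e.1 e.2.2.1).mp e.2.2.2
    have h2 := card_val_ne_zero he
    have h3 := Finset.card_filter_add_card_filter_not (s := Finset.univ) (fun y => e.val y = 0)
    rw [Finset.card_univ, Fintype.card_fin] at h3
    change (Finset.univ.filter fun y => e.val y = 0).card < k at h1
    simp only [ne_eq] at h2
    omega
  exact Nat.card_of_isEmpty

end Star

/-- Theorem (from the proof of paper Thm. `Homology_Complement`): for the `k`-uniform star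
hypergraph `H'` at the vertex `1` on `n` vertices (`3 ≤ k ≤ n-1`), the quotient complex
`Δ(H')^C` satisfies `dim HC_r(Δ(H')^C) = C(n-1, r+1)` for `n-2 ≥ r ≥ n-k+1`,
`dim HC_{n-k}(Δ(H')^C) = C(n-1, n-k+1)`, and `HC_r(Δ(H')^C) = 0` for `r ≤ n-k-1`.
Below `q = r + 1`; homological degree `r` corresponds to partitions with `q + 1` blocks. -/
theorem dim_HC_complement_star (n k : ℕ) (hk : 3 ≤ k) (hkn : k ≤ n - 1) :
    (∀ q : ℕ, n - k + 2 ≤ q → q ≤ n - 1 →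
      Module.finrank ℚ (homologyOf (cycBnd n (starFree n k) (q + 1))
        (cycBnd n (starFree n k) q)) = Nat.choose (n - 1) q) ∧
    (Module.finrank ℚ (homologyOf (cycBnd n (starFree n k) (n - k + 1 + 1))
        (cycBnd n (starFree n k) (n - k + 1))) = Nat.choose (n - 1) (n - k + 1)) ∧
    (∀ q : ℕ, q ≤ n - k →
      Module.finrank ℚ (homologyOf (cycBnd n (starFree n k) (q + 1))
        (cycBnd n (starFree n k) q)) = 0) := by
  have hn : 0 < n := by omega
  have hk0 : 0 < k := by omega
  have hP := zeroMonotone_starFree (k := k) hn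
  refine ⟨fun q hq _ => ?_, ?_, fun q hq => ?_⟩
  · rw [finrank_homologyOf_cycBnd hn hP, card_increasing_starFree hn hk0 (by omega)]
  · rw [finrank_homologyOf_cycBnd hn hP, card_increasing_starFree hn hk0 (by omega)]
  · rw [finrank_homologyOf_cycBnd hn hP, card_increasing_starFree_eq_zero hn hk0 (by omega)]
end

section
/- Let 3 ≤ k ≤ n−1, let W_1, W_2, ..., W_N (N = C(n,k)) be the k-element subsets of {1,...,n} listed in lexicographic order, and let p = C(n−1,k−1), so that W_1,...,W_p are exactly the k-subsets containing 1. Then for every l with p+1 ≤ l ≤ N, the chain complex Δ(E_n^{(1,W_l)}) satisfies dim HC_{n−k−1}(Δ(E_n^{(1,W_l)})) = 1. -/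
open Function

/-- Lexicographic (strict) order on finsets of `Fin n`: `s < t` iff at the smallest element
where the increasing lists of `s` and `t` differ, `s` has the smaller element; equivalently,
some element of `s \ t` is smaller than every element of `t \ s`. -/
def lexLT {n : ℕ} (s t : Finset (Fin n)) : Prop :=
  ∃ x ∈ s \ t, ∀ y ∈ t \ s, x < y

instance {n : ℕ} (s t : Finset (Fin n)) : Decidable (lexLT s t) := by
  unfold lexLT; infer_instance

/-- Condition on partitions for the complex `Δ(E_n^{(1,W)})` where `W` is a `k`-subset:
no block contains a `k`-subset that is lexicographically smaller than `W`, but some block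
contains `W`. -/
def wIn (n k : ℕ) (W : Finset (Fin n)) : (m : ℕ) → (Fin n → Fin m) → Prop := fun m f =>
  (∀ U : Finset (Fin n), U.card = k → lexLT U W → ∀ i : Fin m, ∃ x ∈ U, f x ≠ i) ∧
  ∃ i : Fin m, ∀ x ∈ W, f x = i

open Equiv

/-- Left translate of a permutation which moves the value at `0` to `0`. -/
def normPerm {M : ℕ} (π : Perm (Fin (M + 2))) : Perm (Fin (M + 2)) :=
  π.trans (Equiv.subRight (π 0))

lemma normPerm_apply {M : ℕ} (π : Perm (Fin (M + 2))) (x : Fin (M + 2)) :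
    normPerm π x = π x - π 0 := rfl

lemma normPerm_zero {M : ℕ} (π : Perm (Fin (M + 2))) : normPerm π 0 = 0 := by
  simp [normPerm_apply]

lemma swap_sub_right {M : ℕ} (i j a x : Fin (M + 2)) :
    swap i j x - a = swap (i - a) (j - a) (x - a) := by
  simp only [swap_apply_def]
  split_ifs <;> simp_all

lemma invariant_of_adjacent {M : ℕ} (w : Fin (M + 2)) (e : Perm (Fin (M + 2)) → ℚ)
    (he : ∀ π, π w = 0 → ∀ j : Fin (M + 2), j ≠ 0 → j + 1 ≠ 0 →
      e (swap j (j + 1) * π) = e π)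
    (ρ π : Perm (Fin (M + 2))) (hρ : ρ 0 = 0) (hπ : π w = 0) : e (ρ * π) = e π := by
  obtain ⟨⟨p, ρ'⟩, rfl⟩ := Equiv.Perm.decomposeFin.symm.surjective ρ
  rw [Equiv.Perm.decomposeFin_symm_apply_zero] at hρ
  subst hρ
  have h1 : ρ' ∈ Submonoid.closure
      (Set.range fun i : Fin M ↦ swap i.castSucc i.succ) := by
    rw [Equiv.Perm.mclosure_swap_castSucc_succ]; trivial
  induction h1 using Submonoid.closure_induction generalizing π with
  | mem x hx =>
    obtain ⟨i, rfl⟩ := hx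
    have : Equiv.Perm.decomposeFin.symm ((0 : Fin (M + 2)), swap i.castSucc i.succ)
        = swap i.castSucc.succ (i.castSucc.succ + 1) := by
      have h2 : i.castSucc.succ + 1 = i.succ.succ := by
        rw [Fin.succ_castSucc, Fin.coeSucc_eq_succ]
      rw [h2]
      ext x
      refine Fin.cases ?_ (fun x => ?_) x
      · rw [Equiv.Perm.decomposeFin_symm_apply_zero, swap_apply_of_ne_of_ne] <;>
          exact (Fin.succ_ne_zero _).symm
      · rw [Equiv.Perm.decomposeFin_symm_apply_succ]
        simp only [swap_apply_def, Fin.succ_inj]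
        split_ifs <;> simp_all
    rw [this]
    apply he π hπ
    · exact Fin.succ_ne_zero _
    · rw [Fin.succ_castSucc, Fin.coeSucc_eq_succ]; exact Fin.succ_ne_zero _
  | one =>
    have : Equiv.Perm.decomposeFin.symm ((0 : Fin (M + 2)), (1 : Perm (Fin (M + 1)))) = 1 := by
      simp; rfl
    rw [this, one_mul]
  | mul x y _ _ hx hy =>
    have : Equiv.Perm.decomposeFin.symm ((0 : Fin (M + 2)), x * y) =
        Equiv.Perm.decomposeFin.symm ((0 : Fin (M + 2)), x) *
        Equiv.Perm.decomposeFin.symm ((0 : Fin (M + 2)), y) := by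
      ext z
      refine Fin.cases ?_ (fun z => ?_) z <;> simp
    rw [this, mul_assoc, hx, hy _ hπ]
    rw [Perm.mul_apply, hπ, Equiv.Perm.decomposeFin_symm_apply_zero]

lemma eq_mul_sign_of_adjacent {M : ℕ} (w : Fin (M + 2))
    (c : Perm (Fin (M + 2)) → ℚ)
    (hA : ∀ σ : Perm (Fin (M + 2)), σ 0 = 0 → ∀ j : Fin (M + 2), j ≠ 0 → j + 1 ≠ 0 →
      σ w ≠ j → σ w ≠ j + 1 → c (swap j (j + 1) * σ) = - c σ)
    (hB : ∀ σ : Perm (Fin (M + 2)), σ 0 = 0 → σ w ≠ 1 →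
      c ((finRotate (M + 2))⁻¹ * (swap 0 1 * σ)) = (-1) ^ M * c σ) :
    ∃ a : ℚ, ∀ σ : Perm (Fin (M + 2)), σ 0 = 0 → c σ = a * (Perm.sign σ : ℤ) := by
  set e : Perm (Fin (M + 2)) → ℚ := fun π => (Perm.sign (normPerm π) : ℤ) * c (normPerm π)
    with he
  have key : ∀ π, π w = 0 → ∀ j : Fin (M + 2), j ≠ 0 → j + 1 ≠ 0 → π 0 = j →
      e (swap j (j + 1) * π) = e π := by
    intro π hπ j hj hj1 h0
    have hN : normPerm (swap j (j + 1) * π)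
        = (finRotate (M + 2))⁻¹ * (swap 0 1 * normPerm π) := by
      rw [eq_inv_mul_iff_mul_eq]
      ext1 x
      simp only [Perm.mul_apply, finRotate_apply, normPerm_apply, h0, swap_apply_left]
      have := swap_sub_right j (j + 1) j (π x)
      rw [sub_self, add_sub_cancel_left] at this
      rw [← this]; abel
    have hNw : normPerm π w ≠ 1 := by
      rw [normPerm_apply, hπ, h0]
      intro h
      apply hj1
      rw [← h]; abel
    simp only [he]
    rw [hN, hB _ (normPerm_zero π) hNw]
    have h01 : (0 : Fin (M + 2)) ≠ 1 := by simp
    simp only [Perm.sign_mul, Perm.sign_inv, sign_finRotate, Perm.sign_swap h01]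
    push_cast
    have : ((-1 : ℚ) ^ M) * (-1) ^ M = 1 := by rw [← mul_pow]; simp
    rw [pow_succ]
    linear_combination ((Perm.sign (normPerm π) : ℤ) : ℚ) * c (normPerm π) * this
  have step : ∀ π, π w = 0 → ∀ j : Fin (M + 2), j ≠ 0 → j + 1 ≠ 0 →
      e (swap j (j + 1) * π) = e π := by
    intro π hπ j hj hj1
    by_cases h0 : π 0 = j
    · exact key π hπ j hj hj1 h0
    by_cases h1 : π 0 = j + 1
    · have := key (swap j (j + 1) * π)
        (by rw [Perm.mul_apply, hπ, swap_apply_of_ne_of_ne hj.symm hj1.symm]) j hj hj1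
        (by rw [Perm.mul_apply, h1, swap_apply_right])
      rw [← this, swap_mul_self_mul]
    · have hN : normPerm (swap j (j + 1) * π)
          = swap (j - π 0) (j - π 0 + 1) * normPerm π := by
        ext1 x
        simp only [Perm.mul_apply, normPerm_apply, swap_apply_of_ne_of_ne h0 h1]
        rw [swap_sub_right]
        congr 2; abel
      have ha := hA (normPerm π) (normPerm_zero π) (j - π 0) (by rwa [sub_ne_zero, ne_comm])
        (by
          intro h
          apply h1
          rw [sub_add_eq_add_sub, sub_eq_zero] at h
          exact h.symm)
        (by
          rw [normPerm_apply, hπ]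
          intro h
          apply hj
          exact (sub_left_injective h).symm)
        (by
          rw [normPerm_apply, hπ]
          intro h
          apply hj1
          rw [sub_add_eq_add_sub] at h
          exact (sub_left_injective h).symm)
      simp only [he]
      rw [hN, ha, Perm.sign_mul, Perm.sign_swap]
      · simp
      · intro h
        have := left_eq_add.mp h
        simp at this
  refine ⟨e (swap 0 w), fun σ hσ => ?_⟩
  set π : Perm (Fin (M + 2)) := σ.trans (Equiv.subRight (σ w)) with hπ
  have hπw : π w = 0 := by simp [hπ]
  have hN : normPerm π = σ := by
    ext1 x
    rw [normPerm_apply]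
    simp [hπ, hσ]
  have h1 : e π = e (swap 0 w) := by
    have h2 := invariant_of_adjacent w e step (π * (swap 0 w)⁻¹) (swap 0 w)
      (by simp [hπw]) (by simp)
    rw [← h2, inv_mul_cancel_right]
  rw [← h1]
  simp only [he, hN]
  have : (((Perm.sign σ : ℤˣ) : ℤ) : ℚ) * ((Perm.sign σ : ℤˣ) : ℤ) = 1 := by
    rw [← Int.cast_mul, ← Units.val_mul, Int.units_mul_self]; simp
  linear_combination (-c σ) * this

lemma mergeMap_val {m : ℕ} (j : Fin m) (x : Fin (m + 1)) :
    (mergeMap j x : ℕ) = if (x : ℕ) ≤ j then (x : ℕ) else x - 1 := by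
  unfold mergeMap
  split_ifs <;> rfl

lemma mergeMap_eq_iff {m : ℕ} (j : Fin m) (x y : Fin (m + 1)) :
    mergeMap j x = mergeMap j y ↔
      x = y ∨ (x = j.castSucc ∧ y = j.succ) ∨ (x = j.succ ∧ y = j.castSucc) := by
  simp only [Fin.ext_iff, mergeMap_val, Fin.val_castSucc, Fin.val_succ]
  split_ifs <;> omega

lemma eq_of_mergeMap_eq {m : ℕ} {j y : Fin m} {x : Fin (m + 1)} (h : mergeMap j x = y) :
    x = y.castSucc ∨ x = y.succ := by
  simp only [Fin.ext_iff, mergeMap_val, Fin.val_castSucc, Fin.val_succ] at *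
  split_ifs at h <;> omega

lemma mergeMap_castSucc_self {m : ℕ} (j : Fin m) : mergeMap j j.castSucc = j := by
  simp [Fin.ext_iff, mergeMap_val]

lemma mergeMap_succ_self {m : ℕ} (j : Fin m) : mergeMap j j.succ = j := by
  simp [Fin.ext_iff, mergeMap_val]

lemma mergeMap_surjective {m : ℕ} (j : Fin m) : Surjective (mergeMap j) := by
  intro y
  by_cases h : y ≤ j
  · refine ⟨y.castSucc, ?_⟩
    simpa [Fin.ext_iff, mergeMap_val] using fun h' => absurd h (not_le.2 h')
  · refine ⟨y.succ, ?_⟩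
    simp only [Fin.le_def] at h
    simp only [Fin.ext_iff, mergeMap_val, Fin.val_succ]
    split_ifs <;> omega

lemma mergeMap_comp_swap {m : ℕ} (j : Fin m) :
    mergeMap j ∘ swap j.castSucc j.succ = mergeMap j := by
  funext x
  simp only [comp_apply, swap_apply_def]
  split_ifs <;> simp_all [mergeMap_castSucc_self, mergeMap_succ_self]

lemma mergeMap_comp_perm_eq_iff {m : ℕ} (i j : Fin m) (τ σ : Perm (Fin (m + 1))) :
    mergeMap i ∘ τ = mergeMap j ∘ σ ↔
      i = j ∧ (τ = σ ∨ τ = swap j.castSucc j.succ * σ) := by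
  constructor
  · intro h
    have h' : ∀ x, mergeMap i (τ x) = mergeMap j (σ x) := fun x => congrFun h x
    have hij : i = j := by
      have h1 := h' (τ⁻¹ i.castSucc)
      have h2 := h' (τ⁻¹ i.succ)
      simp only [Perm.coe_inv, Equiv.apply_symm_apply, mergeMap_castSucc_self, mergeMap_succ_self] at h1 h2
      have h3 := (mergeMap_eq_iff j _ _).1 (h1.symm.trans h2)
      rcases h3 with h3 | h3 | h3
      · simp [Fin.ext_iff] at h3
      · rw [h1, h3.1, mergeMap_castSucc_self]
      · rw [h1, h3.1, mergeMap_succ_self]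
    subst hij
    refine ⟨rfl, ?_⟩
    have h2 : ∀ x, mergeMap i ((τ * σ⁻¹) x) = mergeMap i x := fun x => by
      rw [Perm.mul_apply, h', Perm.coe_inv, Equiv.apply_symm_apply]
    suffices h3 : τ * σ⁻¹ = 1 ∨ τ * σ⁻¹ = swap i.castSucc i.succ by
      rcases h3 with h3 | h3
      · exact Or.inl (mul_inv_eq_one.1 h3)
      · exact Or.inr (mul_inv_eq_iff_eq_mul.1 h3)
    generalize τ * σ⁻¹ = ρ at h2
    have hne : i.castSucc ≠ i.succ := by simp [Fin.ext_iff]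
    have h3 := fun x => (mergeMap_eq_iff i _ _).1 (h2 x)
    have hinj := ρ.injective
    have hother : ∀ x, x ≠ i.castSucc → x ≠ i.succ → ρ x = x := fun x hx hx' => by
      rcases h3 x with h | h | h
      · exact h
      · exact absurd h.2 hx'
      · exact absurd h.2 hx
    by_cases hc : ρ i.castSucc = i.castSucc
    · left
      have hs : ρ i.succ = i.succ := by
        rcases h3 i.succ with h | h | h
        · exact h
        · exact absurd (hinj (hc.trans h.1.symm)) hne
        · exact h.1
      ext1 x
      by_cases hx : x = i.castSucc
      · rw [hx, hc]; rfl
      by_cases hx' : x = i.succ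
      · rw [hx', hs]; rfl
      · exact hother x hx hx'
    · right
      have hc' : ρ i.castSucc = i.succ := by
        rcases h3 i.castSucc with h | h | h
        · exact absurd h hc
        · exact absurd h.2 hne
        · exact h.1
      have hs : ρ i.succ = i.castSucc := by
        rcases h3 i.succ with h | h | h
        · exact absurd (hinj (hc'.trans h.symm)) hne
        · exact h.1
        · exact absurd h.2 hne.symm
      ext1 x
      by_cases hx : x = i.castSucc
      · rw [hx, hc', swap_apply_left]
      by_cases hx' : x = i.succ
      · rw [hx', hs, swap_apply_right]
      · rw [hother x hx hx', swap_apply_of_ne_of_ne hx hx']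
  · rintro ⟨rfl, rfl | rfl⟩
    · rfl
    · rw [Perm.coe_mul, ← comp_assoc, mergeMap_comp_swap]

/-- Merging the last block into the first is a rotation followed by merging the first two. -/
lemma wrap_iff {n M : ℕ} (f : Fin n → Fin (M + 2)) (g : Fin n → Fin (M + 1)) :
    (∀ y : Fin n, ((f y : ℕ) = M + 1 → (g y : ℕ) = 0) ∧
        ((f y : ℕ) ≠ M + 1 → (g y : ℕ) = (f y : ℕ))) ↔
      mergeMap 0 ∘ finRotate (M + 2) ∘ f = g := by
  rw [funext_iff]
  refine forall_congr' fun y => ?_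
  simp only [comp_apply, Fin.ext_iff, mergeMap_val, coe_finRotate, Fin.val_last]
  generalize g y = b
  have := (f y).isLt
  by_cases h : (f y : ℕ) = M + 1
  · have h' : f y = Fin.last (M + 1) := Fin.ext h
    simp [h', eq_comm]
  · have h' : f y ≠ Fin.last (M + 1) := fun h' => h (by rw [h']; rfl)
    simp [h, eq_comm]

/-- Coefficient of the boundary of a partition encoded by the permutation `τ`, read off by a
functional `F` on collapsed partitions. -/
def permBnd {M : ℕ} (F : (Fin (M + 2) → Fin (M + 1)) → ℚ) (τ : Perm (Fin (M + 2))) : ℚ :=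
  (∑ j : Fin (M + 1), (-1 : ℚ) ^ (j : ℕ) * F (mergeMap j ∘ τ)) +
    (-1 : ℚ) ^ (M + 1) * F (mergeMap 0 ∘ (finRotate (M + 2) * τ : Perm (Fin (M + 2))))

lemma sum_sign_mul_permBnd {M : ℕ} (F : (Fin (M + 2) → Fin (M + 1)) → ℚ) :
    ∑ τ : Perm (Fin (M + 2)) with τ 0 = 0, ((Perm.sign τ : ℤ) : ℚ) * permBnd F τ = 0 := by
  have h01 : (0 : Fin (M + 2)) ≠ 1 := by simp
  have hpos : ∀ j : Fin M, ∑ τ : Perm (Fin (M + 2)) with τ 0 = 0,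
      ((Perm.sign τ : ℤ) : ℚ) * ((-1 : ℚ) ^ (j.succ : ℕ) * F (mergeMap j.succ ∘ τ)) = 0 := by
    intro j
    have hne : j.succ.castSucc ≠ j.succ.succ := by simp [Fin.ext_iff]
    refine Finset.sum_involution (fun τ _ => swap j.succ.castSucc j.succ.succ * τ) ?_ ?_ ?_ ?_
    · intro τ _
      rw [Perm.coe_mul, ← comp_assoc, mergeMap_comp_swap, Perm.sign_mul, Perm.sign_swap hne]
      simp
    · intro τ _ _ h
      rw [mul_eq_right, swap_eq_one_iff] at h
      exact hne h
    · intro τ hτ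
      simp only [Finset.mem_filter, Finset.mem_univ, true_and] at hτ ⊢
      rw [Perm.mul_apply, hτ, swap_apply_of_ne_of_ne] <;> simp [Fin.ext_iff]
    · intro τ _
      rw [swap_mul_self_mul]
  have hwrap : ∑ τ : Perm (Fin (M + 2)) with τ 0 = 0, ((Perm.sign τ : ℤ) : ℚ) *
        ((-1 : ℚ) ^ (M + 1) * F (mergeMap 0 ∘ (finRotate (M + 2) * τ : Perm (Fin (M + 2))))) =
      ∑ τ : Perm (Fin (M + 2)) with τ 0 = 0, -(((Perm.sign τ : ℤ) : ℚ) * F (mergeMap 0 ∘ τ)) := by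
    refine Finset.sum_nbij' (fun τ => swap 0 1 * (finRotate (M + 2) * τ))
      (fun τ => (finRotate (M + 2))⁻¹ * (swap 0 1 * τ)) ?_ ?_ ?_ ?_ ?_
    · intro τ hτ
      simp only [Finset.mem_filter, Finset.mem_univ, true_and] at hτ ⊢
      simp [hτ]
    · intro τ hτ
      simp only [Finset.mem_filter, Finset.mem_univ, true_and] at hτ ⊢
      rw [Perm.mul_apply, Perm.inv_eq_iff_eq]
      simp [hτ]
    · intro τ _
      simp
    · intro τ _
      simp
    · intro τ _
      have := mergeMap_comp_swap (0 : Fin (M + 1))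
      simp only [Fin.castSucc_zero, Fin.succ_zero_eq_one] at this
      rw [Perm.coe_mul (swap 0 1), ← comp_assoc, this]
      simp only [Perm.sign_mul, sign_finRotate, Perm.sign_swap h01]
      push_cast
      ring
  simp only [permBnd, mul_add, Finset.sum_add_distrib]
  rw [hwrap]
  simp only [Finset.mul_sum]
  rw [Finset.sum_comm, Fin.sum_univ_succ]
  rw [Finset.sum_congr rfl fun j _ => hpos j]
  simp

lemma sum_mul_permBnd_of_ne_zero {M : ℕ} (c : Perm (Fin (M + 2)) → ℚ)
    (σ : Perm (Fin (M + 2))) (hσ : σ 0 = 0) (j : Fin (M + 1)) (hj : j ≠ 0) :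
    ∑ τ : Perm (Fin (M + 2)) with τ 0 = 0,
      c τ * permBnd (fun h => if h = mergeMap j ∘ σ then 1 else 0) τ =
    (-1) ^ (j : ℕ) * (c σ + c (swap j.castSucc j.succ * σ)) := by
  have hs : (swap j.castSucc j.succ * σ) 0 = 0 := by
    rw [Perm.mul_apply, hσ, swap_apply_of_ne_of_ne]
    · exact fun h => hj (Fin.castSucc_eq_zero_iff.1 h.symm)
    · exact (Fin.succ_ne_zero j).symm
  have hne : σ ≠ swap j.castSucc j.succ * σ := by
    intro h
    rw [right_eq_mul, swap_eq_one_iff] at h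
    simp [Fin.ext_iff] at h
  have hb : ∀ τ : Perm (Fin (M + 2)),
      permBnd (fun h => if h = mergeMap j ∘ σ then 1 else 0) τ =
      (-1) ^ (j : ℕ) *
        ((if τ = σ then 1 else 0) + (if τ = swap j.castSucc j.succ * σ then 1 else 0)) := by
    intro τ
    simp only [permBnd, mergeMap_comp_perm_eq_iff]
    rw [Finset.sum_eq_single j]
    · simp only [hj.symm, false_and, if_false, mul_zero, add_zero, true_and]
      by_cases h : τ = σ
      · simp [h, hne]
      · simp [h]
    · intro i _ hi
      simp [hi]
    · simp
  simp only [hb, mul_add, Finset.sum_add_distrib, mul_ite, mul_one, mul_zero]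
  rw [Finset.sum_ite_eq', Finset.sum_ite_eq']
  simp only [Finset.mem_filter, Finset.mem_univ, true_and, hσ, hs, if_true]
  ring

lemma sum_mul_permBnd_zero {M : ℕ} (c : Perm (Fin (M + 2)) → ℚ)
    (σ : Perm (Fin (M + 2))) (hσ : σ 0 = 0) :
    ∑ τ : Perm (Fin (M + 2)) with τ 0 = 0,
      c τ * permBnd (fun h => if h = mergeMap 0 ∘ σ then 1 else 0) τ =
    c σ + (-1) ^ (M + 1) * c ((finRotate (M + 2))⁻¹ * (swap 0 1 * σ)) := by
  have hs : ((finRotate (M + 2))⁻¹ * (swap 0 1 * σ) : Perm (Fin (M + 2))) 0 = 0 := by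
    rw [Perm.mul_apply, Perm.inv_eq_iff_eq]
    simp [hσ]
  have hb : ∀ τ : Perm (Fin (M + 2)), τ 0 = 0 →
      permBnd (fun h => if h = mergeMap 0 ∘ σ then 1 else 0) τ =
      (if τ = σ then 1 else 0) + (-1) ^ (M + 1) *
        (if τ = (finRotate (M + 2))⁻¹ * (swap 0 1 * σ) then 1 else 0) := by
    intro τ hτ
    simp only [permBnd, mergeMap_comp_perm_eq_iff, Fin.castSucc_zero, Fin.succ_zero_eq_one]
    have h1 : τ ≠ swap 0 1 * σ := by
      intro h
      have := congrArg (fun ρ : Perm (Fin (M + 2)) => ρ 0) h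
      simp [hτ, hσ] at this
    have h2 : finRotate (M + 2) * τ ≠ σ := by
      intro h
      have := congrArg (fun ρ : Perm (Fin (M + 2)) => ρ 0) h
      simp [hτ, hσ] at this
    rw [Finset.sum_eq_single 0]
    · simp [h1, h2, eq_inv_mul_iff_mul_eq]
    · intro i _ hi
      simp [hi]
    · simp
  rw [Finset.sum_congr rfl fun τ hτ => by rw [hb τ (Finset.mem_filter.1 hτ).2]]
  simp only [mul_add, Finset.sum_add_distrib, mul_ite, mul_one, mul_zero]
  rw [Finset.sum_ite_eq', Finset.sum_ite_eq']
  simp only [Finset.mem_filter, Finset.mem_univ, true_and, hσ, hs, if_true]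
  ring

/-- If top-dimensional faces are encoded by permutations fixing `0`, and all merges not involving
the block `w` are allowed, then the top-dimensional cycles are spanned by the sign cycle. -/
lemma finrank_ker_cycBnd {n M : ℕ} (P : (m : ℕ) → (Fin n → Fin m) → Prop)
    (r : Fin n → Fin (M + 2)) (hr : Surjective r) {w : Fin (M + 2)} (hw : w ≠ 0)
    (hbas : ∀ f : Fin n → Fin (M + 2),
      (Surjective f ∧ (∀ x : Fin n, (x : ℕ) = 0 → (f x : ℕ) = 0) ∧ P (M + 2) f) ↔
        ∃ σ : Perm (Fin (M + 2)), σ 0 = 0 ∧ σ ∘ r = f)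
    (htgt : ∀ (σ : Perm (Fin (M + 2))) (j : Fin (M + 1)), σ 0 = 0 → σ w ≠ j.castSucc →
      σ w ≠ j.succ → Surjective (mergeMap j ∘ σ ∘ r) ∧
        (∀ x : Fin n, (x : ℕ) = 0 → (mergeMap j (σ (r x)) : ℕ) = 0) ∧
        P (M + 1) (mergeMap j ∘ σ ∘ r)) :
    Module.finrank ℚ (LinearMap.ker (cycBnd n P (M + 1))) = 1 := by
  classical
  let b : {σ : Perm (Fin (M + 2)) // σ 0 = 0} → CycBas n P (M + 2) :=
    fun σ => ⟨σ.1 ∘ r, (hbas _).2 ⟨σ.1, σ.2, rfl⟩⟩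
  have hb : Function.Bijective b := by
    constructor
    · intro σ τ h
      have h1 : σ.1 ∘ r = τ.1 ∘ r := congrArg Subtype.val h
      exact Subtype.ext (DFunLike.coe_injective (hr.injective_comp_right h1))
    · intro f
      obtain ⟨σ, hσ, h⟩ := (hbas _).1 f.2
      exact ⟨⟨σ, hσ⟩, Subtype.ext h⟩
  let B := Equiv.ofBijective b hb
  let coef : (CycBas n P (M + 2) → ℚ) → Perm (Fin (M + 2)) → ℚ :=
    fun v σ => if h : σ 0 = 0 then v (b ⟨σ, h⟩) else 0
  have hbnd : ∀ (v : CycBas n P (M + 2) → ℚ) (g : CycBas n P (M + 1)),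
      cycBnd n P (M + 1) v g = ∑ τ : Perm (Fin (M + 2)) with τ 0 = 0,
        coef v τ * permBnd (fun h => if h ∘ r = g.1 then 1 else 0) τ := by
    intro v g
    change ∑ f, v f * cycMat n P (M + 1) f g = _
    rw [← Equiv.sum_comp B, ← Finset.sum_subtype_of_mem (p := fun τ => τ 0 = 0)
      (fun τ => coef v τ * permBnd (fun h => if h ∘ r = g.1 then 1 else 0) τ)
      (fun τ hτ => (Finset.mem_filter.1 hτ).2)]
    refine Finset.sum_congr (by ext ⟨a, ha⟩; simp [ha]) fun σ _ => ?_
    have h1 : coef v σ.1 = v (B σ) := dif_pos σ.2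
    rw [h1, cycMat, permBnd]
    congr 3
    simp only [wrap_iff]
    rfl
  let s : CycBas n P (M + 2) → ℚ := fun f => ((Perm.sign (B.symm f).1 : ℤ) : ℚ)
  have hs : ∀ σ : Perm (Fin (M + 2)), ∀ h : σ 0 = 0, s (b ⟨σ, h⟩) = (Perm.sign σ : ℤ) := by
    intro σ h
    have : B.symm (b ⟨σ, h⟩) = ⟨σ, h⟩ := B.symm_apply_apply _
    simp only [s, this]
  have hsker : s ∈ LinearMap.ker (cycBnd n P (M + 1)) := by
    rw [LinearMap.mem_ker]
    funext g
    rw [hbnd]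
    refine Eq.trans (Finset.sum_congr rfl fun τ hτ => ?_)
      (sum_sign_mul_permBnd fun h => if h ∘ r = g.1 then 1 else 0)
    have h0 := (Finset.mem_filter.1 hτ).2
    have : coef s τ = (Perm.sign τ : ℤ) := by
      rw [← hs τ h0]
      exact dif_pos h0
    rw [this]
  refine finrank_eq_one ⟨s, hsker⟩ ?_ ?_
  · intro h
    have h1 : s (b ⟨1, Perm.one_apply 0⟩) = 0 := congrFun (congrArg Subtype.val h) _
    rw [hs] at h1
    simp at h1
  · rintro ⟨v, hv⟩
    rw [LinearMap.mem_ker] at hv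
    have hrel : ∀ σ : Perm (Fin (M + 2)), σ 0 = 0 → ∀ j : Fin (M + 1), σ w ≠ j.castSucc →
        σ w ≠ j.succ → ∑ τ : Perm (Fin (M + 2)) with τ 0 = 0,
        coef v τ * permBnd (fun h => if h = mergeMap j ∘ σ then 1 else 0) τ = 0 := by
      intro σ hσ j h1 h2
      refine Eq.trans ?_ ((hbnd v ⟨_, htgt σ j hσ h1 h2⟩).symm.trans (congrFun hv _))
      refine Finset.sum_congr rfl fun τ _ => ?_
      congr 2
      funext h
      have : h = mergeMap j ∘ σ ↔ h ∘ r = mergeMap j ∘ σ ∘ r :=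
        ⟨fun h' => by rw [h']; rfl, fun h' => hr.injective_comp_right h'⟩
      simp only [this]
    obtain ⟨a, ha⟩ := eq_mul_sign_of_adjacent w (coef v) (by
      intro σ hσ j hj hj1 h1 h2
      have hlast : j ≠ Fin.last (M + 1) := by
        rintro rfl
        exact hj1 (Fin.last_add_one _)
      obtain ⟨i, rfl⟩ := Fin.exists_castSucc_eq.2 hlast
      rw [Fin.coeSucc_eq_succ] at h2 ⊢
      have hi : i ≠ 0 := fun h => hj (by rw [h]; rfl)
      have h3 := hrel σ hσ i h1 h2
      rw [sum_mul_permBnd_of_ne_zero _ σ hσ i hi] at h3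
      have h4 := (mul_eq_zero.1 h3).resolve_left (pow_ne_zero _ (by norm_num))
      linarith) (by
      intro σ hσ h1
      have h3 := hrel σ hσ 0 (fun h => hw (σ.injective (h.trans hσ.symm))) h1
      rw [sum_mul_permBnd_zero _ σ hσ] at h3
      have : ((-1 : ℚ) ^ M) * (-1) ^ M = 1 := by rw [← mul_pow]; simp
      rw [pow_succ] at h3
      linear_combination (-(-1) ^ M) * h3 +
        (-coef v ((finRotate (M + 2))⁻¹ * (swap 0 1 * σ))) * this)
    refine ⟨a, Subtype.ext (funext fun f => ?_)⟩
    obtain ⟨⟨σ, hσ⟩, rfl⟩ := hb.2 f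
    have h1 : coef v σ = v (b ⟨σ, hσ⟩) := dif_pos hσ
    change a * s _ = v _
    rw [hs, ← h1, ha σ hσ]

lemma not_lexLT_self {n : ℕ} (s : Finset (Fin n)) : ¬ lexLT s s := by
  rintro ⟨x, hx, -⟩
  simp at hx

/-- A set preceded by at least `C(n-1, k-1)` sets of the same size does not contain the least
vertex. -/
lemma zero_notMem_of_choose_le {n k : ℕ} (W : Finset (Fin (n + 1))) (hW : W.card = k)
    (h : n.choose (k - 1) ≤ ((Finset.powersetCard k (Finset.univ : Finset (Fin (n + 1)))).filter
      (fun U => lexLT U W)).card) : (0 : Fin (n + 1)) ∉ W := by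
  intro h0
  set S := (Finset.powersetCard (k - 1) ((Finset.univ : Finset (Fin (n + 1))).erase 0)).image
    (insert 0)
  have hS : S.card ≤ n.choose (k - 1) := by
    refine Finset.card_image_le.trans ?_
    simp
  have hmem : ∀ U : Finset (Fin (n + 1)), U.card = k → (0 : Fin (n + 1)) ∈ U → U ∈ S := by
    intro U hU h0
    refine Finset.mem_image.2 ⟨U.erase 0, ?_, Finset.insert_erase h0⟩
    rw [Finset.mem_powersetCard, Finset.card_erase_of_mem h0, hU]
    exact ⟨Finset.erase_subset_erase _ (Finset.subset_univ _), rfl⟩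
  refine absurd (Finset.card_lt_card (t := S) (Finset.ssubset_iff_subset_ne.2 ⟨?_, ?_⟩))
    (not_lt.2 (hS.trans h))
  · intro U hU
    rw [Finset.mem_filter, Finset.mem_powersetCard] at hU
    obtain ⟨⟨-, hU⟩, x, -, hx⟩ := hU
    refine hmem U hU ?_
    by_contra h1
    have := hx 0 (Finset.mem_sdiff.2 ⟨h0, h1⟩)
    simp at this
  · intro h1
    have := hmem W hW h0
    rw [← h1, Finset.mem_filter] at this
    exact not_lexLT_self W this.2

/-- Collapsing `W` to a point identifies the quotient of the vertex set with `Fin`, in such a way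
that the vertex `0` corresponds to `0`. -/
lemma exists_collapse {n k M : ℕ} (hn : n + 1 = k + M + 1) (W : Finset (Fin (n + 1)))
    (hW : W.card = k) (hk : 0 < k) (h0 : (0 : Fin (n + 1)) ∉ W) :
    ∃ (r : Fin (n + 1) → Fin (M + 2)) (w : Fin (M + 2)), Surjective r ∧ w ≠ 0 ∧ r 0 = 0 ∧
      (∀ x, r x = w ↔ x ∈ W) ∧ (∀ x y, r x = r y → x = y ∨ (x ∈ W ∧ y ∈ W)) := by
  obtain ⟨w0, hw0⟩ := Finset.card_pos.1 (hW ▸ hk)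
  let Q := insert w0 (Finset.univ \ W)
  have hQ : Q.card = M + 2 := by
    rw [Finset.card_insert_of_notMem (by simp [hw0]), Finset.card_sdiff_of_subset
      (Finset.subset_univ _), hW]
    simp
    omega
  have hQ0 : (0 : Fin (n + 1)) ∈ Q := by simp [Q, h0]
  let e := Q.equivFinOfCardEq hQ
  let e' := e.trans (swap (e ⟨0, hQ0⟩) 0)
  have hp : ∀ x, (if x ∈ W then w0 else x) ∈ Q := by
    intro x
    split_ifs with h <;> simp [Q, h]
  refine ⟨fun x => e' ⟨_, hp x⟩, e' ⟨w0, by simp [Q]⟩, ?_, ?_, ?_, ?_, ?_⟩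
  · intro y
    obtain ⟨⟨x, hx⟩, rfl⟩ := e'.surjective y
    refine ⟨x, ?_⟩
    simp only [EmbeddingLike.apply_eq_iff_eq, Subtype.mk.injEq]
    split_ifs with h
    · simpa [Q, h, eq_comm] using hx
    · rfl
  · have : e' ⟨0, hQ0⟩ = 0 := by simp [e']
    rw [← this]
    simp only [ne_eq, EmbeddingLike.apply_eq_iff_eq, Subtype.mk.injEq]
    rintro rfl
    exact h0 hw0
  · simp [e', h0]
  · intro x
    simp only [EmbeddingLike.apply_eq_iff_eq, Subtype.mk.injEq]
    split_ifs with h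
    · simp [h]
    · simp only [h, iff_false]
      rintro rfl
      exact h hw0
  · intro x y h
    simp only [EmbeddingLike.apply_eq_iff_eq, Subtype.mk.injEq] at h
    split_ifs at h with h1 h2 h2
    · exact Or.inr ⟨h1, h2⟩
    · exact absurd (h ▸ hw0) h2
    · exact absurd (h ▸ hw0) h1
    · exact Or.inl h

/-- A partition which has `W` as a block and whose other blocks have at most two elements satisfies
the condition defining the complex of `W`. -/
lemma wIn_comp_of_fiber {n k m q : ℕ} (hk : 3 ≤ k) {W : Finset (Fin n)} (hW : W.card = k)
    {r : Fin n → Fin q} {w : Fin q} (hw : ∀ x, r x = w ↔ x ∈ W)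
    (hr : ∀ x y, r x = r y → x = y ∨ (x ∈ W ∧ y ∈ W)) (φ : Fin q → Fin m)
    (hφ : ∀ y, ∃ a b, ∀ x, φ x = y → x = a ∨ x = b) (hφw : ∀ x, φ x = φ w → x = w) :
    wIn n k W m (φ ∘ r) := by
  refine ⟨fun U hU hlt i => ?_, φ w, fun x hx => ?_⟩
  · by_contra! h
    simp only [comp_apply] at h
    by_cases hi : i = φ w
    · have hUW : U ⊆ W := fun x hx => (hw x).1 (hφw _ ((h x hx).trans hi))
      rw [Finset.eq_of_subset_of_card_le hUW (by rw [hU, hW])] at hlt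
      exact not_lexLT_self W hlt
    · have hinj : Set.InjOn r U := by
        intro x hx y _ hxy
        refine (hr x y hxy).resolve_right fun h1 => hi ?_
        rw [← h x hx, (hw x).2 h1.1]
      obtain ⟨a, b, hab⟩ := hφ i
      have h1 : U.image r ⊆ {a, b} := by
        intro z hz
        obtain ⟨x, hx, rfl⟩ := Finset.mem_image.1 hz
        simpa using hab _ (h x hx)
      have h2 := (Finset.card_le_card h1).trans Finset.card_le_two
      rw [Finset.card_image_of_injOn hinj] at h2
      omega
  · rw [comp_apply, (hw x).2 hx]

/-- Partitions having all of `W` inside one block have at most `n - |W| + 1` blocks. -/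
lemma card_le_of_constant_on {n m : ℕ} {W : Finset (Fin n)} {f : Fin n → Fin m}
    (hf : Surjective f) {i : Fin m} (hi : ∀ x ∈ W, f x = i) : m ≤ n - W.card + 1 := by
  have h : (Finset.univ : Finset (Fin m)) ⊆ insert i ((Finset.univ \ W).image f) := by
    intro y _
    obtain ⟨x, rfl⟩ := hf y
    by_cases hx : x ∈ W
    · simp [hi x hx]
    · exact Finset.mem_insert_of_mem (Finset.mem_image_of_mem _ (by simp [hx]))
  have h1 := (Finset.card_le_card h).trans (Finset.card_insert_le _ _)
  have h2 := Finset.card_image_le (s := Finset.univ \ W) (f := f)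
  rw [Finset.card_sdiff_of_subset (Finset.subset_univ _)] at h2
  simp only [Finset.card_univ, Fintype.card_fin] at h1 h2
  omega

lemma finrank_homologyOf_of_isEmpty {α B C : Type} [IsEmpty α] [AddCommGroup B] [AddCommGroup C]
    [Module ℚ B] [Module ℚ C] (d2 : (α → ℚ) →ₗ[ℚ] B) (d1 : B →ₗ[ℚ] C) :
    Module.finrank ℚ (homologyOf d2 d1) = Module.finrank ℚ (LinearMap.ker d1) := by
  have h : d2 = 0 := by
    refine LinearMap.ext fun x => ?_
    rw [Subsingleton.elim x 0, map_zero, map_zero]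
  have hbot : (LinearMap.range d2).comap (LinearMap.ker d1).subtype = ⊥ := by
    rw [h, LinearMap.range_zero, Submodule.comap_bot, Submodule.ker_subtype]
  exact (Submodule.quotEquivOfEqBot _ hbot).finrank_eq

/-- Theorem (from the proof of paper Thm. `Homology_Complement`): let `W_1, …, W_N`
(`N = C(n,k)`) be the `k`-subsets of the vertex set in lexicographic order and
`p = C(n-1, k-1)`, so that `W_1, …, W_p` are the `k`-subsets containing the vertex `1`.
For `p + 1 ≤ l ≤ N`, the complex `Δ(E_n^{(1,W_l)})` has
`dim HC_{n-k-1}(Δ(E_n^{(1,W_l)})) = 1`.  Here `W` being the `l`-th `k`-subset in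
lexicographic order is expressed by saying that exactly `l - 1` of the `k`-subsets
are lexicographically smaller than `W`.  Homological degree `n-k-1` corresponds to
partitions with `n-k+1` blocks. -/
theorem dim_HC_wComplex (n k : ℕ) (hk : 3 ≤ k) (hkn : k ≤ n - 1)
    (l : ℕ) (W : Finset (Fin n)) (hW : W.card = k)
    (hl1 : Nat.choose (n - 1) (k - 1) + 1 ≤ l) (hl2 : l ≤ Nat.choose n k)
    (hlex : ((Finset.powersetCard k (Finset.univ : Finset (Fin n))).filter
      (fun U => lexLT U W)).card = l - 1) :
    Module.finrank ℚ (homologyOf (cycBnd n (wIn n k W) (n - k + 1))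
      (cycBnd n (wIn n k W) (n - k))) = 1 := by
  obtain ⟨M, rfl⟩ : ∃ M, n = k + M + 1 := ⟨n - 1 - k, by omega⟩
  have h0 : (0 : Fin (k + M + 1)) ∉ W :=
    zero_notMem_of_choose_le W hW (by rw [hlex]; simpa using Nat.le_sub_one_of_lt hl1)
  obtain ⟨r, w, hr, hw0, hr0, hrw, hrinj⟩ := exists_collapse rfl W hW (by omega) h0
  have hM : k + M + 1 - k = M + 1 := by omega
  rw [hM]
  have : IsEmpty (CycBas (k + M + 1) (wIn (k + M + 1) k W) (M + 1 + 1 + 1)) := by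
    refine ⟨fun f => ?_⟩
    obtain ⟨f, hf, -, -, i, hi⟩ := f
    have := card_le_of_constant_on hf hi
    omega
  rw [finrank_homologyOf_of_isEmpty]
  have hz : ∀ x : Fin (k + M + 1), (x : ℕ) = 0 → x = 0 := fun x hx => Fin.ext hx
  refine finrank_ker_cycBnd _ r hr hw0 (fun f => ⟨?_, ?_⟩) fun σ j hσ h1 h2 => ⟨?_, ?_, ?_⟩
  · rintro ⟨hf, hf0, -, i, hi⟩
    have hfac : ∀ x y, r x = r y → f x = f y := fun x y hxy => by
      rcases hrinj x y hxy with rfl | h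
      · rfl
      · rw [hi x h.1, hi y h.2]
    have hh : ∀ x, f (surjInv hr (r x)) = f x := fun x => hfac _ _ (surjInv_eq hr _)
    have hsurj : Surjective (f ∘ surjInv hr) := fun y => by
      obtain ⟨x, rfl⟩ := hf y
      exact ⟨r x, hh x⟩
    refine ⟨Equiv.ofBijective _ (Finite.surjective_iff_bijective.1 hsurj), ?_, ?_⟩
    · have := hh 0
      rw [hr0] at this
      exact this.trans (Fin.ext (hf0 0 rfl))
    · funext x
      exact hh x
  · rintro ⟨σ, hσ, rfl⟩
    refine ⟨σ.surjective.comp hr, fun x hx => ?_, ?_⟩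
    · rw [hz x hx, comp_apply, hr0, hσ]; rfl
    · exact wIn_comp_of_fiber hk hW hrw hrinj σ
        (fun y => ⟨σ.symm y, σ.symm y, fun x hx => Or.inl (by simp [← hx])⟩)
        (fun x hx => σ.injective hx)
  · exact (mergeMap_surjective j).comp (σ.surjective.comp hr)
  · intro x hx
    rw [hz x hx, hr0, hσ, mergeMap_val]
    simp
  · refine wIn_comp_of_fiber hk hW hrw hrinj (mergeMap j ∘ σ)
      (fun y => ⟨σ.symm y.castSucc, σ.symm y.succ, fun x hx => ?_⟩) (fun x hx => ?_)
    · rw [Equiv.eq_symm_apply, Equiv.eq_symm_apply]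
      exact eq_of_mergeMap_eq hx
    · rcases (mergeMap_eq_iff j _ _).1 hx with h | h | h
      · exact σ.injective h
      · exact absurd h.2 h2
      · exact absurd h.2 h1
end
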